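/- arXiv:2312.02414 — 2 statements merged into one kernel-verified Lean document; each statement's English description precedes it below -/
import Mathlib

section
/- Let f : ℝ_{>0} → ℝ_{>0} be an increasing function with ∑_{k=1}^∞ 1/f(k) < ∞. Then for almost every m×n real matrix B there exists Q₀ > 0 such that for all Q ≥ Q₀ one has sup_{v ∈ ℝ^m} γ_{(B;Q)}(v) < Q^{−1/m} (f(log Q))^{1/m}; in particular γ_{(B;Q)}(Bk) < Q^{−1/m} (f(log Q))^{1/m} for every k ∈ ℤ^n ∩ (0, Q^{1/n}]^n. -/
open MeasureTheory
open scoped ENNReal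

/-- The `L^p` norm of a vector in `ℝ^ι`, for `p ∈ [1,∞]` (junk values otherwise). -/
noncomputable def lpNorm (p : ℝ≥0∞) {ι : Type*} [Fintype ι] (x : ι → ℝ) : ℝ :=
  ‖(WithLp.equiv p (ι → ℝ)).symm x‖

/-- The Euclidean (`L²`) norm of a vector. -/
noncomputable def euclNorm {ι : Type*} [Fintype ι] (x : ι → ℝ) : ℝ :=
  Real.sqrt (∑ i, x i ^ 2)

/-- `cone(S) = {c • u : u ∈ S, c > 0}`. -/
def cone {m : ℕ} (S : Set (Fin m → ℝ)) : Set (Fin m → ℝ) :=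
  {y | ∃ u ∈ S, ∃ c : ℝ, 0 < c ∧ y = c • u}

/-- `S` is an open subset of the unit (Euclidean) sphere of `ℝ^m`. -/
def IsOpenSubsetOfSphere {m : ℕ} (S : Set (Fin m → ℝ)) : Prop :=
  ∃ U : Set (Fin m → ℝ), IsOpen U ∧ S = U ∩ {u | euclNorm u = 1}

/-- Matrix-vector multiplication, with the matrix given as `Fin m → Fin n → ℝ`. -/
def matVec {m n : ℕ} (B : Fin m → Fin n → ℝ) (x : Fin n → ℝ) : Fin m → ℝ :=
  fun i => ∑ j, B i j * x j

/-- The gap function `γ_{(B;Q)}(v)`: the infimum of `‖Bk + l − v‖_p` over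
`k ∈ ℤ^n ∩ (0, Q^{1/n}]^n`, `l ∈ ℤ^m` with `Bk + l − v ∈ cone S`;
the infimum of the empty set is `∞`. -/
noncomputable def gap (p : ℝ≥0∞) {m n : ℕ} (S : Set (Fin m → ℝ))
    (B : Fin m → Fin n → ℝ) (Q : ℝ) (v : Fin m → ℝ) : ℝ≥0∞ :=
  ⨅ (k : Fin n → ℤ) (_ : ∀ i, 0 < (k i : ℝ) ∧ (k i : ℝ) ≤ Q ^ ((n : ℝ)⁻¹))
    (l : Fin m → ℤ)
    (_ : (matVec B (fun j => (k j : ℝ)) + (fun i => (l i : ℝ)) - v) ∈ cone S),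
    ENNReal.ofReal (lpNorm p (matVec B (fun j => (k j : ℝ)) + (fun i => (l i : ℝ)) - v))

/-! ### Exponential sums -/

noncomputable def ee (t : ℝ) : ℂ := Complex.exp (Complex.I * ((2 * Real.pi * t : ℝ) : ℂ))

lemma ee_add (s t : ℝ) : ee (s + t) = ee s * ee t := by
  unfold ee; rw [← Complex.exp_add]; congr 1; push_cast; ring

lemma ee_zero : ee 0 = 1 := by simp [ee]

lemma ee_norm (t : ℝ) : ‖ee t‖ = 1 := by
  unfold ee; rw [mul_comm]; exact Complex.norm_exp_ofReal_mul_I _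

lemma ee_conj (t : ℝ) : (starRingEnd ℂ) (ee t) = ee (-t) := by
  unfold ee; rw [← Complex.exp_conj]; congr 1
  rw [map_mul, Complex.conj_I, Complex.conj_ofReal]; push_cast; ring

lemma ee_int (z : ℤ) : ee z = 1 := by
  unfold ee; rw [Complex.exp_eq_one_iff]; exact ⟨z, by push_cast; ring⟩

lemma ee_sum {ι : Type*} (s : Finset ι) (g : ι → ℝ) : ee (∑ i ∈ s, g i) = ∏ i ∈ s, ee (g i) := by
  classical
  induction s using Finset.induction_on with
  | empty => simp [ee_zero]
  | insert a s ha ih => rw [Finset.sum_insert ha, Finset.prod_insert ha, ee_add, ih]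

lemma ee_continuous : Continuous ee := by unfold ee; fun_prop

lemma far_lemma (x ρ : ℝ) (h : ∀ l : ℤ, ρ ≤ |x + l|) : 4 * ρ ≤ ‖1 - ee x‖ := by
  have h1 := h (-(round x))
  have h2 : |x - round x| ≤ 1 / 2 := abs_sub_round x
  set y : ℝ := x - round x with hy
  have h3 : ee x = ee y := by
    have : x = y + (round x : ℤ) := by simp [hy]
    conv_lhs => rw [this]
    rw [ee_add, ee_int, mul_one]
  have h4 : ρ ≤ |y| := by
    have : x + ((-(round x) : ℤ) : ℝ) = y := by rw [hy]; push_cast; ring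
    rwa [this] at h1
  rw [h3, norm_sub_rev]
  unfold ee
  rw [Complex.norm_exp_I_mul_ofReal_sub_one, Real.norm_eq_abs, abs_mul]
  have h5 : 2 * Real.pi * y / 2 = Real.pi * y := by ring
  rw [h5]
  have h6 : |Real.sin (Real.pi * y)| = |Real.sin (Real.pi * |y|)| := by
    rcases abs_cases y with ⟨h, _⟩ | ⟨h, _⟩ <;> rw [h]
    rw [mul_neg, Real.sin_neg, abs_neg]
  have h7 : 2 / Real.pi * (Real.pi * |y|) ≤ Real.sin (Real.pi * |y|) :=
    Real.mul_le_sin (by positivity) (by nlinarith [Real.pi_pos])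
  have h8 : 2 / Real.pi * (Real.pi * |y|) = 2 * |y| := by
    field_simp
  rw [h6]
  have := le_abs_self (Real.sin (Real.pi * |y|))
  rw [abs_two]
  linarith

/-- the bilinear phase `a · B k` -/
noncomputable def ph {m n : ℕ} (B : Fin m → Fin n → ℝ) (a : Fin m → ℤ) (k : Fin n → ℤ) : ℝ :=
  ∑ i, ∑ j, (a i : ℝ) * (B i j * (k j : ℝ))

lemma ph_sub_left {m n : ℕ} (B : Fin m → Fin n → ℝ) (a b : Fin m → ℤ) (k : Fin n → ℤ) :
    ph B (a - b) k = ph B a k - ph B b k := by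
  simp only [ph, ← Finset.sum_sub_distrib, Pi.sub_apply, Int.cast_sub, sub_mul]

lemma ph_sub_right {m n : ℕ} (B : Fin m → Fin n → ℝ) (a : Fin m → ℤ) (k k' : Fin n → ℤ) :
    ph B a (k - k') = ph B a k - ph B a k' := by
  simp only [ph, ← Finset.sum_sub_distrib, Pi.sub_apply, Int.cast_sub, mul_sub]

/-- the (Fejér type) kernel -/
noncomputable def FF {m n : ℕ} (X : Finset (Fin n → ℤ)) (t : Fin m → ℤ)
    (B : Fin m → Fin n → ℝ) : ℝ := ‖∑ k ∈ X, ee (ph B t k)‖ ^ 2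

lemma FF_nonneg {m n : ℕ} (X : Finset (Fin n → ℤ)) (t : Fin m → ℤ)
    (B : Fin m → Fin n → ℝ) : 0 ≤ FF X t B := by unfold FF; positivity

lemma FF_zero {m n : ℕ} (X : Finset (Fin n → ℤ)) (B : Fin m → Fin n → ℝ) :
    FF X 0 B = (X.card : ℝ) ^ 2 := by
  simp [FF, ph, ee_zero]

lemma FF_eq {m n : ℕ} (X : Finset (Fin n → ℤ)) (t : Fin m → ℤ) (B : Fin m → Fin n → ℝ) :
    (FF X t B : ℂ) = ∑ k ∈ X, ∑ k' ∈ X, ee (ph B t (k - k')) := by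
  unfold FF
  push_cast
  rw [← Complex.mul_conj', map_sum, Finset.sum_mul_sum]
  refine Finset.sum_congr rfl fun k _ => Finset.sum_congr rfl fun k' _ => ?_
  rw [ee_conj, ← ee_add, ph_sub_right, sub_eq_add_neg]

lemma FF_neg {m n : ℕ} (X : Finset (Fin n → ℤ)) (t : Fin m → ℤ) (B : Fin m → Fin n → ℝ) :
    FF X (-t) B = FF X t B := by
  have h : ∀ k, ee (ph B (-t) k) = (starRingEnd ℂ) (ee (ph B t k)) := by
    intro k
    rw [ee_conj, ← zero_sub, ph_sub_left]
    simp [ph]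
  unfold FF
  simp only [h]
  rw [← map_sum, Complex.norm_conj]

lemma quad_eq {m n : ℕ} (X : Finset (Fin n → ℤ)) (P : Finset (Fin m → ℤ))
    (c : (Fin m → ℤ) → ℂ) (B : Fin m → Fin n → ℝ) :
    ((∑ k ∈ X, ∑ k' ∈ X, ‖∑ a ∈ P, c a * ee (ph B a (k - k'))‖ ^ 2 : ℝ) : ℂ)
      = ∑ a ∈ P, ∑ b ∈ P, c a * (starRingEnd ℂ) (c b) * (FF X (a - b) B : ℂ) := by
  set T : (Fin n → ℤ) → (Fin n → ℤ) → (Fin m → ℤ) → (Fin m → ℤ) → ℂ := fun k k' a b =>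
    c a * ee (ph B a (k - k')) * (starRingEnd ℂ) (c b * ee (ph B b (k - k'))) with hT
  have h1 : ((∑ k ∈ X, ∑ k' ∈ X, ‖∑ a ∈ P, c a * ee (ph B a (k - k'))‖ ^ 2 : ℝ) : ℂ)
      = ∑ k ∈ X, ∑ k' ∈ X, ∑ a ∈ P, ∑ b ∈ P, T k k' a b := by
    push_cast
    refine Finset.sum_congr rfl fun k _ => Finset.sum_congr rfl fun k' _ => ?_
    rw [← Complex.mul_conj', map_sum, Finset.sum_mul_sum]
  have h2 : ∑ a ∈ P, ∑ b ∈ P, c a * (starRingEnd ℂ) (c b) * (FF X (a - b) B : ℂ)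
      = ∑ a ∈ P, ∑ b ∈ P, ∑ k ∈ X, ∑ k' ∈ X, T k k' a b := by
    refine Finset.sum_congr rfl fun a _ => Finset.sum_congr rfl fun b _ => ?_
    rw [FF_eq, Finset.mul_sum]
    refine Finset.sum_congr rfl fun k _ => ?_
    rw [Finset.mul_sum]
    refine Finset.sum_congr rfl fun k' _ => ?_
    simp only [hT]
    rw [map_mul, ee_conj, ph_sub_left, sub_eq_add_neg (ph B a _), ee_add]
    ring
  rw [h1, h2]
  calc _ = ∑ q ∈ X ×ˢ X, ∑ r ∈ P ×ˢ P, T q.1 q.2 r.1 r.2 := by simp only [Finset.sum_product]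
    _ = ∑ r ∈ P ×ˢ P, ∑ q ∈ X ×ˢ X, T q.1 q.2 r.1 r.2 := Finset.sum_comm
    _ = _ := by simp only [Finset.sum_product]

lemma quad_bound {m n : ℕ} (X : Finset (Fin n → ℤ)) (P : Finset (Fin m → ℤ))
    (c : (Fin m → ℤ) → ℂ) (B : Fin m → Fin n → ℝ) (E : ℝ)
    (hE : ∀ a ∈ P, ∑ b ∈ P.erase a, FF X (a - b) B ≤ E) :
    |(∑ k ∈ X, ∑ k' ∈ X, ‖∑ a ∈ P, c a * ee (ph B a (k - k'))‖ ^ 2)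
      - (X.card : ℝ) ^ 2 * ∑ a ∈ P, ‖c a‖ ^ 2| ≤ E * ∑ a ∈ P, ‖c a‖ ^ 2 := by
  classical
  rw [← Real.norm_eq_abs, ← Complex.norm_real, Complex.ofReal_sub, quad_eq]
  have h1 : ∀ a ∈ P, ∑ b ∈ P, c a * (starRingEnd ℂ) (c b) * (FF X (a - b) B : ℂ)
      = ((X.card : ℝ) ^ 2 * ‖c a‖ ^ 2 : ℝ)
        + ∑ b ∈ P.erase a, c a * (starRingEnd ℂ) (c b) * (FF X (a - b) B : ℂ) := by
    intro a ha
    rw [← Finset.add_sum_erase P _ ha, sub_self, FF_zero, Complex.mul_conj']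
    push_cast; ring
  rw [Finset.sum_congr rfl h1, Finset.sum_add_distrib, ← Complex.ofReal_sum, ← Finset.mul_sum,
    add_sub_cancel_left]
  have hswap : ∑ a ∈ P, ∑ b ∈ P.erase a, ‖c b‖ ^ 2 * FF X (a - b) B
      = ∑ a ∈ P, ∑ b ∈ P.erase a, ‖c a‖ ^ 2 * FF X (a - b) B := by
    rw [Finset.sum_comm' (t' := P) (s' := fun a => P.erase a)]
    · refine Finset.sum_congr rfl fun a _ => Finset.sum_congr rfl fun b _ => ?_
      rw [← FF_neg, neg_sub]
    · intro a b
      simp only [Finset.mem_erase]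
      tauto
  calc _ ≤ ∑ a ∈ P, ‖∑ b ∈ P.erase a, c a * (starRingEnd ℂ) (c b) * (FF X (a - b) B : ℂ)‖ :=
        norm_sum_le _ _
    _ ≤ ∑ a ∈ P, ∑ b ∈ P.erase a, ‖c a * (starRingEnd ℂ) (c b) * (FF X (a - b) B : ℂ)‖ :=
        Finset.sum_le_sum fun a _ => norm_sum_le _ _
    _ ≤ ∑ a ∈ P, ∑ b ∈ P.erase a, (1 / 2 * (‖c a‖ ^ 2 * FF X (a - b) B)
          + 1 / 2 * (‖c b‖ ^ 2 * FF X (a - b) B)) := by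
        refine Finset.sum_le_sum fun a _ => Finset.sum_le_sum fun b _ => ?_
        rw [norm_mul, norm_mul, Complex.norm_conj, Complex.norm_real, Real.norm_eq_abs,
          abs_of_nonneg (FF_nonneg _ _ _)]
        have := FF_nonneg X (a - b) B
        nlinarith [mul_nonneg this (sq_nonneg (‖c a‖ - ‖c b‖))]
    _ = ∑ a ∈ P, ∑ b ∈ P.erase a, ‖c a‖ ^ 2 * FF X (a - b) B := by
        simp only [Finset.sum_add_distrib, ← Finset.mul_sum]
        simp only [Finset.mul_sum] at hswap ⊢
        simp only [← Finset.mul_sum] at hswap ⊢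
        rw [hswap]; ring
    _ ≤ ∑ a ∈ P, ‖c a‖ ^ 2 * E := by
        refine Finset.sum_le_sum fun a ha => ?_
        rw [← Finset.mul_sum]
        exact mul_le_mul_of_nonneg_left (hE a ha) (by positivity)
    _ = E * ∑ a ∈ P, ‖c a‖ ^ 2 := by rw [← Finset.sum_mul, mul_comm]

/-- integer box `[-L, L]^m` -/
noncomputable def bx (m L : ℕ) : Finset (Fin m → ℤ) := Fintype.piFinset fun _ => Finset.Icc (-(L : ℤ)) L

lemma mem_bx {m L : ℕ} (a : Fin m → ℤ) : a ∈ bx m L ↔ ‖a‖ ≤ L := by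
  rw [bx, Fintype.mem_piFinset, pi_norm_le_iff_of_nonneg (by positivity)]
  refine forall_congr' fun i => ?_
  rw [Finset.mem_Icc, Int.norm_eq_abs, ← Int.cast_abs, ← Int.cast_natCast (R := ℝ), Int.cast_le,
    abs_le]

lemma card_bx (m L : ℕ) : (bx m L).card = (2 * L + 1) ^ m := by
  simp only [bx, Fintype.card_piFinset, Int.card_Icc, Finset.prod_const, Finset.card_univ,
    Fintype.card_fin]
  congr 1
  omega

/-- integer box `[0, K)^n` -/
noncomputable def kx (n K : ℕ) : Finset (Fin n → ℤ) := Fintype.piFinset fun _ => Finset.Ico (0 : ℤ) K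

lemma card_kx (n K : ℕ) : (kx n K).card = K ^ n := by
  simp [kx, Fintype.card_piFinset]

/-- the tent function -/
noncomputable def tent {m : ℕ} (M : ℕ) (a : Fin m → ℤ) : ℝ := max 0 (2 * M - ‖a‖)

lemma tent_lip {m : ℕ} (M : ℕ) (a : Fin m → ℤ) (i : Fin m) :
    |tent M a - tent M (a - Pi.single i 1)| ≤ 1 := by
  have h : ‖(Pi.single i 1 : Fin m → ℤ)‖ ≤ 1 := by
    rw [pi_norm_le_iff_of_nonneg (by norm_num)]
    intro j
    by_cases hj : j = i
    · subst hj; simp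
    · simp [Pi.single_eq_of_ne hj]
  have h2 := abs_norm_sub_norm_le (a - Pi.single i 1) a
  rw [sub_sub_cancel_left, norm_neg] at h2
  unfold tent
  refine (abs_max_sub_max_le_max _ _ _ _).trans ?_
  simp only [sub_self, abs_zero]
  refine max_le zero_le_one ?_
  have : 2 * (M : ℝ) - ‖a‖ - (2 * M - ‖a - Pi.single i 1‖) = ‖a - Pi.single i 1‖ - ‖a‖ := by ring
  rw [this]
  exact h2.trans h

lemma tent_sq {m : ℕ} (M : ℕ) :
    (2 * M + 1 : ℝ) ^ m * M ^ 2 ≤ ∑ a ∈ bx m (2 * M), tent M a ^ 2 := by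
  have hsub : bx m M ⊆ bx m (2 * M) := by
    intro a ha
    rw [mem_bx] at *
    push_cast
    have : (0 : ℝ) ≤ M := by positivity
    linarith
  calc (2 * M + 1 : ℝ) ^ m * M ^ 2 = ∑ a ∈ bx m M, (M : ℝ) ^ 2 := by
        rw [Finset.sum_const, card_bx]; simp
    _ ≤ ∑ a ∈ bx m M, tent M a ^ 2 := by
        refine Finset.sum_le_sum fun a ha => ?_
        rw [mem_bx] at ha
        refine pow_le_pow_left₀ (by positivity) ?_ 2
        exact le_trans (by linarith) (le_max_right _ _)
    _ ≤ _ := Finset.sum_le_sum_of_subset_of_nonneg hsub fun a _ _ => sq_nonneg _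

lemma tent_zero {m : ℕ} (M : ℕ) (a : Fin m → ℤ) (h : (2 * M : ℝ) - 1 < ‖a‖) : tent M a = 0 := by
  have h1 : (2 * M : ℝ) ≤ ‖a‖ := by
    by_contra hlt
    push Not at hlt
    by_cases hM : M = 0
    · subst hM; simp at hlt; exact absurd hlt (not_lt.2 (norm_nonneg _))
    · have : a ∈ bx m (2 * M - 1) := by
        rw [bx, Fintype.mem_piFinset]
        intro i
        have := (norm_le_pi_norm a i).trans_lt hlt
        rw [Int.norm_eq_abs, ← Int.cast_abs] at this
        have h3 : |a i| < 2 * (M : ℤ) := by exact_mod_cast this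
        rw [abs_lt] at h3
        rw [Finset.mem_Icc]; omega
      rw [mem_bx] at this
      rw [Nat.cast_sub (by omega)] at this
      push_cast at this
      linarith
  unfold tent
  exact max_eq_left (by linarith)

lemma shift_lemma {m : ℕ} (M : ℕ) (i : Fin m) (x : Fin m → ℝ) :
    (1 - ee (x i)) * ∑ a ∈ bx m (2 * M), (tent M a : ℂ) * ee (∑ r, (a r : ℝ) * x r)
      = ∑ a ∈ bx m (2 * M), ((tent M a - tent M (a - Pi.single i 1) : ℝ) : ℂ)
          * ee (∑ r, (a r : ℝ) * x r) := by
  have hs : ‖(Pi.single i 1 : Fin m → ℤ)‖ ≤ 1 := by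
    rw [pi_norm_le_iff_of_nonneg (by norm_num)]
    intro j
    by_cases hj : j = i
    · subst hj; simp
    · simp [Pi.single_eq_of_ne hj]
  have key : ee (x i) * ∑ a ∈ bx m (2 * M), (tent M a : ℂ) * ee (∑ r, (a r : ℝ) * x r)
      = ∑ a ∈ bx m (2 * M), (tent M (a - Pi.single i 1) : ℂ) * ee (∑ r, (a r : ℝ) * x r) := by
    rw [← tsum_eq_sum (L := .unconditional _) (s := bx m (2 * M)), ← tsum_eq_sum (L := .unconditional _) (s := bx m (2 * M)), ← tsum_mul_left]
    · refine Eq.trans (tsum_congr fun a => ?_)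
        ((Equiv.addRight (Pi.single i 1 : Fin m → ℤ)).tsum_eq
          (fun a => (tent M (a - Pi.single i 1) : ℂ) * ee (∑ r, (a r : ℝ) * x r)))
      have : ∑ r, (((a + Pi.single i 1 : Fin m → ℤ) r : ℤ) : ℝ) * x r
          = (∑ r, (a r : ℝ) * x r) + x i := by
        simp only [Pi.add_apply, Int.cast_add, add_mul, Finset.sum_add_distrib]
        congr 1
        rw [Finset.sum_eq_single i]
        · simp
        · intro b _ hb; simp [Pi.single_eq_of_ne hb]
        · simp
      simp only [Equiv.coe_addRight, add_sub_cancel_right]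
      rw [this, ee_add]; ring
    · intro a ha
      rw [mem_bx] at ha
      push_cast at ha
      rw [tent_zero, Complex.ofReal_zero, zero_mul]
      have := norm_sub_norm_le a (Pi.single i 1)
      linarith
    · intro a ha
      rw [mem_bx] at ha
      push_cast at ha
      rw [tent_zero, Complex.ofReal_zero, zero_mul]
      linarith
  rw [sub_mul, one_mul, key, ← Finset.sum_sub_distrib]
  refine Finset.sum_congr rfl fun a _ => ?_
  push_cast; ring

/-! ### The deterministic transference lemma -/

/-- the off-diagonal mass -/
noncomputable def offd {m n : ℕ} (K M : ℕ) (B : Fin m → Fin n → ℝ) : ℝ :=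
  ∑ t ∈ (bx m (4 * M)).erase 0, FF (kx n K) t B

lemma offd_le {m n : ℕ} (K M : ℕ) (B : Fin m → Fin n → ℝ) (a : Fin m → ℤ)
    (ha : a ∈ bx m (2 * M)) :
    ∑ b ∈ (bx m (2 * M)).erase a, FF (kx n K) (a - b) B ≤ offd K M B := by
  classical
  have hinj : Set.InjOn (fun b : Fin m → ℤ => a - b) ((bx m (2 * M)).erase a) := by
    intro b _ b' _ h
    simpa using h
  rw [← Finset.sum_image (f := fun t => FF (kx n K) t B) hinj]
  refine Finset.sum_le_sum_of_subset_of_nonneg ?_ fun t _ _ => FF_nonneg _ _ _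
  intro t ht
  rw [Finset.mem_image] at ht
  obtain ⟨b, hb, rfl⟩ := ht
  rw [Finset.mem_erase] at hb ⊢
  refine ⟨fun h => hb.1 (sub_eq_zero.1 h).symm, ?_⟩
  have h2 := hb.2
  rw [mem_bx] at *
  push_cast at *
  have := norm_sub_le a b
  linarith

lemma det_aux {m n : ℕ} (hm : 1 ≤ m) (B : Fin m → Fin n → ℝ) (K M : ℕ) (hK : 1 ≤ K) (hM : 1 ≤ M)
    (ρ : ℝ) (hρ : 0 < ρ) (hC : (m : ℝ) * 2 ^ m ≤ ρ * M)
    (hE : offd K M B ≤ (K ^ n : ℝ) ^ 2 / 2) (u : Fin m → ℝ) :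
    ∃ k ∈ kx n K, ∃ k' ∈ kx n K, ∀ i, ∃ l : ℤ,
      |matVec B (fun j => ((k - k') j : ℝ)) i - u i + l| < ρ := by
  by_contra hcon
  push Not at hcon
  set X := kx n K with hX
  set P := bx m (2 * M) with hP
  set N : ℝ := (K : ℝ) ^ n with hN
  have hcard : (X.card : ℝ) = N := by rw [hX, card_kx]; simp [hN]
  have hNpos : 0 < N := by rw [hN]; positivity
  -- the point attached to a pair
  let x : (Fin n → ℤ) → Fin m → ℝ := fun q i => matVec B (fun j => (q j : ℝ)) i - u i
  have hx : ∀ (a : Fin m → ℤ) (q : Fin n → ℤ),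
      ∑ r, (a r : ℝ) * x q r = ph B a q + (-∑ r, (a r : ℝ) * u r) := by
    intro a q
    simp only [x, ph, matVec, mul_sub, Finset.sum_sub_distrib, Finset.mul_sum]
    ring
  have hform : ∀ (s : (Fin m → ℤ) → ℝ) (q : Fin n → ℤ),
      ∑ a ∈ P, (s a : ℂ) * ee (∑ r, (a r : ℝ) * x q r)
        = ∑ a ∈ P, ((s a : ℂ) * ee (-∑ r, (a r : ℝ) * u r)) * ee (ph B a q) := by
    intro s q
    refine Finset.sum_congr rfl fun a _ => ?_
    rw [hx, ee_add]; ring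
  have hq : ∀ s : (Fin m → ℤ) → ℝ,
      |(∑ k ∈ X, ∑ k' ∈ X, ‖∑ a ∈ P, (s a : ℂ) * ee (∑ r, (a r : ℝ) * x (k - k') r)‖ ^ 2)
        - N ^ 2 * ∑ a ∈ P, s a ^ 2| ≤ N ^ 2 / 2 * ∑ a ∈ P, s a ^ 2 := by
    intro s
    have h := quad_bound X P (fun a => (s a : ℂ) * ee (-∑ r, (a r : ℝ) * u r)) B (N ^ 2 / 2)
      (fun a ha => (offd_le K M B a ha).trans hE)
    have hn : ∀ a, ‖(s a : ℂ) * ee (-∑ r, (a r : ℝ) * u r)‖ ^ 2 = s a ^ 2 := by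
      intro a
      rw [norm_mul, ee_norm, mul_one, Complex.norm_real, Real.norm_eq_abs, sq_abs]
    simp only [hn, hcard] at h
    simp only [hform]
    exact h
  set D : (Fin n → ℤ) → ℂ := fun q => ∑ a ∈ P, (tent M a : ℂ) * ee (∑ r, (a r : ℝ) * x q r) with hD
  set A : ℝ := ∑ a ∈ P, tent M a ^ 2 with hA
  have hlow : N ^ 2 / 2 * A ≤ ∑ k ∈ X, ∑ k' ∈ X, ‖D (k - k')‖ ^ 2 := by
    have := (abs_le.1 (hq (tent M))).1
    simp only [hD]
    linarith
  have hup : ∀ i, ∑ k ∈ X, ∑ k' ∈ X, ‖(1 - ee (x (k - k') i)) * D (k - k')‖ ^ 2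
      ≤ 3 / 2 * N ^ 2 * (4 * M + 1) ^ m := by
    intro i
    have h1 := (abs_le.1 (hq (fun a => tent M a - tent M (a - Pi.single i 1)))).2
    have h2 : ∑ a ∈ P, (tent M a - tent M (a - Pi.single i 1)) ^ 2 ≤ (4 * M + 1 : ℝ) ^ m := by
      calc _ ≤ ∑ a ∈ P, (1 : ℝ) := by
            refine Finset.sum_le_sum fun a _ => ?_
            rw [← sq_abs]
            exact pow_le_one₀ (abs_nonneg _) (tent_lip M a i)
        _ = _ := by
            rw [Finset.sum_const, hP, card_bx]; simp; ring
    simp only [hD, hP, shift_lemma]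
    rw [← hP]
    have h3 : 3 / 2 * N ^ 2 * ∑ a ∈ P, (tent M a - tent M (a - Pi.single i 1)) ^ 2
        ≤ 3 / 2 * N ^ 2 * (4 * M + 1 : ℝ) ^ m := mul_le_mul_of_nonneg_left h2 (by positivity)
    linarith
  have hfar : ∀ k ∈ X, ∀ k' ∈ X, 16 * ρ ^ 2 * ‖D (k - k')‖ ^ 2
      ≤ ∑ i, ‖(1 - ee (x (k - k') i)) * D (k - k')‖ ^ 2 := by
    intro k hk k' hk'
    obtain ⟨i, hi⟩ := hcon k hk k' hk'
    have h1 : 4 * ρ ≤ ‖1 - ee (x (k - k') i)‖ := far_lemma _ _ hi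
    calc _ ≤ ‖(1 - ee (x (k - k') i)) * D (k - k')‖ ^ 2 := by
          rw [norm_mul, mul_pow]
          refine mul_le_mul_of_nonneg_right ?_ (by positivity)
          nlinarith
      _ ≤ _ := Finset.single_le_sum (f := fun i => ‖(1 - ee (x (k - k') i)) * D (k - k')‖ ^ 2)
          (fun i _ => by positivity) (Finset.mem_univ i)
  have hsum : 16 * ρ ^ 2 * (N ^ 2 / 2 * A) ≤ m * (3 / 2 * N ^ 2 * (4 * M + 1) ^ m) := by
    calc _ ≤ 16 * ρ ^ 2 * ∑ k ∈ X, ∑ k' ∈ X, ‖D (k - k')‖ ^ 2 :=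
          mul_le_mul_of_nonneg_left hlow (by positivity)
      _ = ∑ k ∈ X, ∑ k' ∈ X, 16 * ρ ^ 2 * ‖D (k - k')‖ ^ 2 := by simp only [Finset.mul_sum]
      _ ≤ ∑ k ∈ X, ∑ k' ∈ X, ∑ i, ‖(1 - ee (x (k - k') i)) * D (k - k')‖ ^ 2 :=
          Finset.sum_le_sum fun k hk => Finset.sum_le_sum fun k' hk' => hfar k hk k' hk'
      _ = ∑ i, ∑ k ∈ X, ∑ k' ∈ X, ‖(1 - ee (x (k - k') i)) * D (k - k')‖ ^ 2 := by
          refine Eq.trans (Finset.sum_congr rfl fun k _ => Finset.sum_comm) ?_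
          rw [Finset.sum_comm]
      _ ≤ ∑ i : Fin m, (3 / 2 * N ^ 2 * (4 * M + 1) ^ m : ℝ) := Finset.sum_le_sum fun i _ => hup i
      _ = _ := by simp
  have hA2 : (2 * M + 1 : ℝ) ^ m * M ^ 2 ≤ A := tent_sq M
  have h4 : (4 * M + 1 : ℝ) ^ m ≤ 2 ^ m * (2 * M + 1) ^ m := by
    rw [← mul_pow]
    exact pow_le_pow_left₀ (by positivity) (by linarith) m
  set Y : ℝ := (2 * M + 1 : ℝ) ^ m with hY
  have hYpos : 0 < Y := by positivity
  have h5 : 8 * ρ ^ 2 * N ^ 2 * (Y * M ^ 2) ≤ 3 / 2 * N ^ 2 * (m * (2 ^ m * Y)) := by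
    calc _ ≤ 8 * ρ ^ 2 * N ^ 2 * A := mul_le_mul_of_nonneg_left hA2 (by positivity)
      _ = 16 * ρ ^ 2 * (N ^ 2 / 2 * A) := by ring
      _ ≤ _ := hsum
      _ = 3 / 2 * N ^ 2 * (m * (4 * M + 1) ^ m) := by ring
      _ ≤ _ := by gcongr
  have h6 : 8 * (ρ * M) ^ 2 ≤ 3 / 2 * (m * 2 ^ m) := by
    have hpos : 0 < N ^ 2 * Y := by positivity
    refine le_of_mul_le_mul_left ?_ hpos
    nlinarith
  have h7 : (1 : ℝ) ≤ m * 2 ^ m := by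
    have h1 : (1 : ℝ) ≤ m := by exact_mod_cast hm
    have h2 : (1 : ℝ) ≤ 2 ^ m := one_le_pow₀ (by norm_num)
    nlinarith
  nlinarith

lemma det_lemma {m n : ℕ} (hm : 1 ≤ m) (B : Fin m → Fin n → ℝ) (K M : ℕ) (hK : 1 ≤ K)
    (hM : 1 ≤ M) (ρ : ℝ) (hρ : 0 < ρ) (hC : (m : ℝ) * 2 ^ m ≤ ρ * M)
    (hE : offd K M B ≤ (K ^ n : ℝ) ^ 2 / 2) (v : Fin m → ℝ) :
    ∃ k : Fin n → ℤ, (∀ j, 0 < k j ∧ k j ≤ 2 * K) ∧ ∃ l : Fin m → ℤ, ∀ i,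
      |matVec B (fun j => (k j : ℝ)) i + l i - v i| < ρ := by
  obtain ⟨k, hk, k', hk', h⟩ := det_aux hm B K M hK hM ρ hρ hC hE
    (fun i => v i - matVec B (fun _ => (K : ℝ)) i)
  choose l hl using h
  refine ⟨fun j => k j - k' j + K, ?_, l, ?_⟩
  · intro j
    rw [kx, Fintype.mem_piFinset] at hk hk'
    have h1 := hk j
    have h2 := hk' j
    rw [Finset.mem_Ico] at h1 h2
    show 0 < k j - k' j + (K : ℤ) ∧ k j - k' j + (K : ℤ) ≤ 2 * K
    omega
  · intro i
    have := hl i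
    convert this using 2
    simp only [matVec, Pi.sub_apply, Int.cast_add, Int.cast_sub, Int.cast_natCast, mul_add,
      Finset.sum_add_distrib]
    ring

/-! ### The measure estimate -/

/-- Lebesgue measure on the unit cube with integer corner `z` -/
noncomputable def cubeM {m n : ℕ} (z : Fin m → Fin n → ℤ) : Measure (Fin m → Fin n → ℝ) :=
  Measure.pi fun i => Measure.pi fun j => volume.restrict (Set.Ioc (z i j : ℝ) (z i j + 1))

lemma prob_Ioc (z : ℤ) : IsProbabilityMeasure (volume.restrict (Set.Ioc (z : ℝ) (z + 1))) :=
  ⟨by simp⟩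

lemma prob_cubeM {m n : ℕ} (z : Fin m → Fin n → ℤ) : IsProbabilityMeasure (cubeM z) := by
  have := fun i j => prob_Ioc (z i j)
  unfold cubeM
  infer_instance

lemma cubeM_eq {m n : ℕ} (z : Fin m → Fin n → ℤ) :
    cubeM z = volume.restrict
      (Set.univ.pi fun i => Set.univ.pi fun j => Set.Ioc (z i j : ℝ) (z i j + 1)) := by
  unfold cubeM
  rw [volume_pi, Measure.restrict_pi_pi]
  congr 1
  funext i
  rw [volume_pi, Measure.restrict_pi_pi]

lemma int_one (z c : ℤ) (hc : c ≠ 0) :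
    ∫ x in Set.Ioc (z : ℝ) (z + 1), ee (c * x) = 0 := by
  rw [← intervalIntegral.integral_of_le (by linarith)]
  have h : ∀ x : ℝ, ee (c * x) = Complex.exp ((Complex.I * (2 * Real.pi * c : ℝ)) * x) := by
    intro x; unfold ee; congr 1; push_cast; ring
  simp only [h]
  rw [integral_exp_mul_complex]
  · rw [← h, ← h]
    have h1 : (c : ℝ) * (z + 1) = ((c * (z + 1) : ℤ) : ℝ) := by push_cast; ring
    have h2 : (c : ℝ) * z = ((c * z : ℤ) : ℝ) := by push_cast; ring
    rw [h1, h2, ee_int, ee_int, sub_self, zero_div]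
  · have : (2 * Real.pi * c : ℝ) ≠ 0 := by
      have : (c : ℝ) ≠ 0 := by exact_mod_cast hc
      positivity
    exact mul_ne_zero Complex.I_ne_zero (by exact_mod_cast this)

lemma int_ph {m n : ℕ} (z : Fin m → Fin n → ℤ) (t : Fin m → ℤ) (ht : t ≠ 0) (q : Fin n → ℤ)
    (hq : q ≠ 0) : ∫ B, ee (ph B t q) ∂(cubeM z) = 0 := by
  obtain ⟨i, hi⟩ := Function.ne_iff.1 ht
  obtain ⟨j, hj⟩ := Function.ne_iff.1 hq
  have := fun i j => prob_Ioc (z i j)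
  have h : ∀ B : Fin m → Fin n → ℝ,
      ee (ph B t q) = ∏ i, ∏ j, ee (((t i * q j : ℤ) : ℝ) * B i j) := by
    intro B
    simp only [ph, ee_sum]
    refine Finset.prod_congr rfl fun i _ => Finset.prod_congr rfl fun j _ => ?_
    congr 1; push_cast; ring
  simp only [h]
  unfold cubeM
  rw [integral_fintype_prod_eq_prod (fun i (b : Fin n → ℝ) => ∏ j, ee (((t i * q j : ℤ) : ℝ) * b j))]
  refine Finset.prod_eq_zero (Finset.mem_univ i) ?_
  rw [integral_fintype_prod_eq_prod (fun j (b : ℝ) => ee (((t i * q j : ℤ) : ℝ) * b))]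
  refine Finset.prod_eq_zero (Finset.mem_univ j) ?_
  exact int_one _ _ (mul_ne_zero hi hj)

lemma cont_ph {m n : ℕ} (t : Fin m → ℤ) (q : Fin n → ℤ) :
    Continuous fun B : Fin m → Fin n → ℝ => ee (ph B t q) := by
  refine ee_continuous.comp ?_
  unfold ph
  fun_prop

lemma integrable_ph {m n : ℕ} (z : Fin m → Fin n → ℤ) (t : Fin m → ℤ) (q : Fin n → ℤ) :
    Integrable (fun B => ee (ph B t q)) (cubeM z) := by
  have := prob_cubeM z
  exact Integrable.of_bound (cont_ph t q).aestronglyMeasurable 1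
    (Filter.Eventually.of_forall fun B => (ee_norm _).le)

lemma integrable_FF {m n : ℕ} (z : Fin m → Fin n → ℤ) (X : Finset (Fin n → ℤ)) (t : Fin m → ℤ) :
    Integrable (fun B => FF X t B) (cubeM z) := by
  have := prob_cubeM z
  refine Integrable.of_bound (C := (X.card : ℝ) ^ 2) ?_ (Filter.Eventually.of_forall fun B => ?_)
  · refine Continuous.aestronglyMeasurable ?_
    unfold FF
    exact ((continuous_finsetSum X fun k _ => cont_ph t k).norm).pow 2
  · rw [Real.norm_eq_abs, abs_of_nonneg (FF_nonneg _ _ _)]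
    unfold FF
    refine pow_le_pow_left₀ (norm_nonneg _) ?_ 2
    refine (norm_sum_le _ _).trans ?_
    simp [ee_norm]

lemma int_FF {m n : ℕ} (z : Fin m → Fin n → ℤ) (X : Finset (Fin n → ℤ)) (t : Fin m → ℤ)
    (ht : t ≠ 0) : ∫ B, FF X t B ∂(cubeM z) = X.card := by
  classical
  have hprob := prob_cubeM z
  have h : ((∫ B, FF X t B ∂(cubeM z) : ℝ) : ℂ) = X.card := by
    rw [← integral_complex_ofReal]
    have h1 : ∀ B : Fin m → Fin n → ℝ, ((FF X t B : ℝ) : ℂ)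
        = ∑ k ∈ X, ∑ k' ∈ X, ee (ph B t (k - k')) := fun B => FF_eq X t B
    refine Eq.trans (integral_congr_ae (Filter.Eventually.of_forall h1)) ?_
    rw [integral_finsetSum _ fun k _ => integrable_finsetSum _ fun k' _ => integrable_ph z t _]
    have h2 : ∀ k ∈ X, ∫ B, ∑ k' ∈ X, ee (ph B t (k - k')) ∂(cubeM z) = 1 := by
      intro k hk
      rw [integral_finsetSum _ fun k' _ => integrable_ph z t _, Finset.sum_eq_single k]
      · simp [ph, ee_zero]
      · intro k' _ hne
        exact int_ph z t ht _ (sub_ne_zero.2 hne.symm)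
      · exact fun h => absurd hk h
    rw [Finset.sum_congr rfl h2]
    simp
  exact_mod_cast h

lemma meas_bad {m n : ℕ} (z : Fin m → Fin n → ℤ) (K M : ℕ) (hK : 1 ≤ K) :
    cubeM z {B | (K ^ n : ℝ) ^ 2 / 2 < offd K M B}
      ≤ ENNReal.ofReal (2 * (8 * M + 1) ^ m / K ^ n) := by
  have hprob := prob_cubeM z
  have hint : Integrable (fun B : Fin m → Fin n → ℝ => offd K M B) (cubeM z) :=
    integrable_finsetSum _ fun t _ => integrable_FF z _ t
  have hval : ∫ B : Fin m → Fin n → ℝ, offd K M B ∂(cubeM z) ≤ (8 * M + 1) ^ m * K ^ n := by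
    unfold offd
    rw [integral_finsetSum _ fun t _ => integrable_FF z _ t,
      Finset.sum_congr rfl fun t ht => int_FF z _ t (Finset.ne_of_mem_erase ht), Finset.sum_const,
      nsmul_eq_mul, card_kx]
    push_cast
    refine mul_le_mul_of_nonneg_right ?_ (by positivity)
    have h1 := Finset.card_erase_le (s := bx m (4 * M)) (a := 0)
    rw [card_bx] at h1
    have : ((2 * (4 * M) + 1) ^ m : ℕ) = (8 * M + 1) ^ m := by congr 1; ring
    rw [this] at h1
    exact_mod_cast h1
  have hmk : (K ^ n : ℝ) ^ 2 / 2 * (cubeM z).real {B | (K ^ n : ℝ) ^ 2 / 2 ≤ offd K M B}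
      ≤ ∫ B : Fin m → Fin n → ℝ, offd K M B ∂(cubeM z) := mul_meas_ge_le_integral_of_nonneg
    (Filter.Eventually.of_forall fun B : Fin m → Fin n → ℝ =>
      Finset.sum_nonneg fun t _ => FF_nonneg (kx n K) t B) hint ((K ^ n : ℝ) ^ 2 / 2)
  have hKpos : (0 : ℝ) < K ^ n := by positivity
  rw [← ENNReal.ofReal_toReal (measure_ne_top (cubeM z) _)]
  refine ENNReal.ofReal_le_ofReal ?_
  rw [← measureReal_def]
  calc (cubeM z).real {B | (K ^ n : ℝ) ^ 2 / 2 < offd K M B}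
      ≤ (cubeM z).real {B | (K ^ n : ℝ) ^ 2 / 2 ≤ offd K M B} :=
        by
        refine measureReal_mono (fun B hB => ?_)
        rw [Set.mem_ofPred_eq] at hB ⊢
        exact hB.le
    _ ≤ _ := by
        rw [le_div_iff₀ hKpos]
        have h := hmk.trans hval
        refine le_of_mul_le_mul_left ?_ hKpos
        nlinarith

lemma ae_of_cubes {m n : ℕ} (p : (Fin m → Fin n → ℝ) → Prop)
    (h : ∀ z : Fin m → Fin n → ℤ, ∀ᵐ B ∂(cubeM z), p B) : ∀ᵐ B : Fin m → Fin n → ℝ, p B := by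
  simp only [cubeM_eq] at h
  rw [← ae_restrict_iUnion_iff] at h
  have hU : (⋃ z : Fin m → Fin n → ℤ, (Set.univ.pi fun i => Set.univ.pi fun j =>
      Set.Ioc (z i j : ℝ) (z i j + 1))) = Set.univ := by
    refine Set.eq_univ_of_forall fun B => ?_
    refine Set.mem_iUnion.2 ⟨fun i j => ⌈B i j⌉ - 1, ?_⟩
    intro i _ j _
    have h1 := Int.ceil_lt_add_one (B i j)
    have h2 := Int.le_ceil (B i j)
    constructor <;> push_cast <;> linarith
  rwa [hU, Measure.restrict_univ] at h

/-! ### Geometry of the cone and conclusion -/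

lemma cone_ball {m : ℕ} (S : Set (Fin m → ℝ)) (hSne : S.Nonempty)
    (hSopen : IsOpenSubsetOfSphere S) :
    ∃ (w : Fin m → ℝ) (δ : ℝ), 0 < δ ∧ δ ≤ 1 ∧ ∀ y, ‖y - w‖ < δ → y ∈ cone S := by
  obtain ⟨U, hU, rfl⟩ := hSopen
  obtain ⟨w, hwU, hw⟩ := hSne
  have hw : euclNorm w = 1 := hw
  have hcont : Continuous (fun y : Fin m → ℝ => euclNorm y) := by
    unfold euclNorm; fun_prop
  have h1 : ContinuousAt (fun y : Fin m → ℝ => (euclNorm y)⁻¹ • y) w := by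
    refine ContinuousAt.smul (ContinuousAt.inv₀ hcont.continuousAt (by simp [hw])) continuousAt_id
  have h2 : ∀ᶠ y in nhds w, (euclNorm y)⁻¹ • y ∈ U := by
    refine h1 ?_
    have : (euclNorm w)⁻¹ • w = w := by simp [hw]
    show U ∈ nhds ((euclNorm w)⁻¹ • w)
    rw [this]
    exact hU.mem_nhds hwU
  have h3 : ∀ᶠ y in nhds w, 0 < euclNorm y := by
    refine hcont.continuousAt.eventually (lt_mem_nhds ?_)
    show 0 < euclNorm w
    rw [hw]; exact one_pos
  obtain ⟨ε, hε, h⟩ := Metric.eventually_nhds_iff.1 (h2.and h3)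
  refine ⟨w, min ε 1, lt_min hε one_pos, min_le_right _ _, fun y hy => ?_⟩
  obtain ⟨hy1, hy2⟩ := h (y := y) (by rw [dist_eq_norm]; exact lt_of_lt_of_le hy (min_le_left _ _))
  refine ⟨(euclNorm y)⁻¹ • y, ⟨hy1, ?_⟩, euclNorm y, hy2, ?_⟩
  · have hsc : ∀ c : ℝ, 0 < c → euclNorm (c • y) = c * euclNorm y := by
      intro c hc
      unfold euclNorm
      simp only [Pi.smul_apply, smul_eq_mul, mul_pow, ← Finset.mul_sum]
      rw [Real.sqrt_mul (by positivity), Real.sqrt_sq hc.le]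
    show euclNorm _ = 1
    rw [hsc _ (inv_pos.2 hy2), inv_mul_cancel₀ hy2.ne']
  · rw [smul_smul, mul_inv_cancel₀ hy2.ne', one_smul]

lemma cone_smul {m : ℕ} {S : Set (Fin m → ℝ)} {y : Fin m → ℝ} (hy : y ∈ cone S) {c : ℝ}
    (hc : 0 < c) : c • y ∈ cone S := by
  obtain ⟨u, hu, d, hd, rfl⟩ := hy
  exact ⟨u, hu, c * d, mul_pos hc hd, by rw [smul_smul]⟩

lemma lp_bound (p : ℝ≥0∞) (hp : 1 ≤ p) (m : ℕ) :
    ∃ C : ℝ, 0 < C ∧ ∀ x : Fin m → ℝ, lpNorm p x ≤ C * ‖x‖ := by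
  have : Fact (1 ≤ p) := ⟨hp⟩
  have h := PiLp.lipschitzWith_toLp p (fun _ : Fin m => ℝ)
  set C := ((Fintype.card (Fin m) : NNReal) ^ (1 / p).toReal) with hC
  refine ⟨C + 1, by positivity, fun x => ?_⟩
  have h1 := h.dist_le_mul x 0
  rw [dist_zero_right, WithLp.toLp_zero, dist_zero_right] at h1
  have h2 : lpNorm p x ≤ C * ‖x‖ := h1
  nlinarith [norm_nonneg x]

lemma gap_le {m n : ℕ} (hm : 1 ≤ m) (p : ℝ≥0∞) (S : Set (Fin m → ℝ))
    (C : ℝ) (hC : 0 < C) (hlp : ∀ x : Fin m → ℝ, lpNorm p x ≤ C * ‖x‖)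
    (w : Fin m → ℝ) (δ : ℝ) (hδ : 0 < δ) (hδ1 : δ ≤ 1) (hw : ∀ y, ‖y - w‖ < δ → y ∈ cone S)
    (B : Fin m → Fin n → ℝ) (K M : ℕ) (hK : 1 ≤ K) (hM : 1 ≤ M) (R : ℝ) (hR : 0 < R)
    (hCM : (m : ℝ) * 2 ^ m ≤ (δ * R) * M)
    (hE : offd K M B ≤ (K ^ n : ℝ) ^ 2 / 2) (Q : ℝ) (hQ : 2 * (K : ℝ) ≤ Q ^ ((n : ℝ)⁻¹))
    (v : Fin m → ℝ) :
    gap p S B Q v ≤ ENNReal.ofReal (C * (‖w‖ + 1) * R) := by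
  obtain ⟨k, hk, l, hl⟩ := det_lemma hm B K M hK hM (δ * R) (by positivity) hCM hE (v + R • w)
  set y : Fin m → ℝ := matVec B (fun j => (k j : ℝ)) + (fun i => (l i : ℝ)) - v with hy
  have hyn : ‖y - R • w‖ < δ * R := by
    rw [pi_norm_lt_iff (by positivity)]
    intro i
    have := hl i
    rw [Real.norm_eq_abs]
    convert this using 2
    simp [hy]; ring
  have hycone : y ∈ cone S := by
    have h1 : R⁻¹ • y ∈ cone S := by
      refine hw _ ?_
      have : R⁻¹ • y - w = R⁻¹ • (y - R • w) := by
        rw [smul_sub R⁻¹ y, smul_smul, inv_mul_cancel₀ hR.ne', one_smul]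
      rw [this, norm_smul, Real.norm_eq_abs, abs_of_pos (inv_pos.2 hR), inv_mul_lt_iff₀ hR]
      linarith
    have h2 := cone_smul h1 hR
    rwa [smul_smul, mul_inv_cancel₀ hR.ne', one_smul] at h2
  have hynorm : ‖y‖ ≤ (‖w‖ + 1) * R := by
    have h1 : ‖y‖ ≤ ‖y - R • w‖ + ‖R • w‖ := by
      simpa using norm_add_le (y - R • w) (R • w)
    rw [norm_smul, Real.norm_eq_abs, abs_of_pos hR] at h1
    nlinarith
  unfold gap
  refine iInf_le_of_le k (iInf_le_of_le ?_ (iInf_le_of_le l (iInf_le_of_le hycone ?_)))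
  · intro i
    refine ⟨by exact_mod_cast (hk i).1, le_trans ?_ hQ⟩
    exact_mod_cast (hk i).2
  · refine ENNReal.ofReal_le_ofReal ?_
    calc lpNorm p y ≤ C * ‖y‖ := hlp y
      _ ≤ C * ((‖w‖ + 1) * R) := by gcongr
      _ = _ := by ring

/-- **Theorem 1(a).** If `f : ℝ_{>0} → ℝ_{>0}` is increasing with `∑ 1/f(k) < ∞`, then for
almost every `m×n` real matrix `B` there is `Q₀ > 0` such that for all `Q ≥ Q₀`,
`sup_{v ∈ ℝ^m} γ_{(B;Q)}(v) < Q^{-1/m} (f(log Q))^{1/m}`; in particular this strict bound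
holds for `γ_{(B;Q)}(Bk)` for every `k ∈ ℤ^n ∩ (0, Q^{1/n}]^n`. -/
theorem gap_upper_bound (m n : ℕ) (hm : 1 ≤ m) (hn : 1 ≤ n)
    (p : ℝ≥0∞) (hp : 1 ≤ p)
    (S : Set (Fin m → ℝ)) (hSne : S.Nonempty) (hSopen : IsOpenSubsetOfSphere S)
    (f : ℝ → ℝ) (hfpos : ∀ x > (0 : ℝ), 0 < f x) (hfmono : MonotoneOn f (Set.Ioi 0))
    (hfsum : Summable fun k : ℕ => 1 / f (k + 1)) :
    ∀ᵐ B : Fin m → Fin n → ℝ ∂volume, ∃ Q₀ > (0 : ℝ), ∀ Q ≥ Q₀,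
      ((⨆ v : Fin m → ℝ, gap p S B Q v)
          < ENNReal.ofReal (Q ^ (-(m : ℝ)⁻¹) * f (Real.log Q) ^ ((m : ℝ)⁻¹))) ∧
      (∀ k : Fin n → ℤ, (∀ i, 0 < (k i : ℝ) ∧ (k i : ℝ) ≤ Q ^ ((n : ℝ)⁻¹)) →
        gap p S B Q (matVec B fun j => (k j : ℝ))
          < ENNReal.ofReal (Q ^ (-(m : ℝ)⁻¹) * f (Real.log Q) ^ ((m : ℝ)⁻¹))) := by
  classical
  obtain ⟨w, δ, hδ, hδ1, hw⟩ := cone_ball S hSne hSopen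
  obtain ⟨C, hC, hlp⟩ := lp_bound p hp m
  set C2 : ℝ := C * (‖w‖ + 1) with hC2
  have hC2pos : 0 < C2 := by positivity
  set c : ℝ := 1 / (3 * C2) with hc
  have hcpos : 0 < c := by positivity
  have hmR : (m : ℝ) ≠ 0 := by positivity
  have hnR : (n : ℝ) ≠ 0 := by positivity
  set H : ℝ := (m : ℝ) * 2 ^ m with hH
  have hH1 : (1 : ℝ) ≤ H := by
    have h1 : (1 : ℝ) ≤ m := by exact_mod_cast hm
    have h2 : (1 : ℝ) ≤ 2 ^ m := one_le_pow₀ (by norm_num)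
    nlinarith
  -- the parameters at level `j`
  let g : ℕ → ℝ := fun j => Real.exp (-j) * f j
  let R : ℕ → ℝ := fun j => min (c * (g j) ^ ((m : ℝ)⁻¹)) 1
  let M : ℕ → ℕ := fun j => ⌈H / (δ * R j)⌉₊
  let K : ℕ → ℕ := fun j => ⌊Real.exp (j / n) / 2⌋₊
  have hg : ∀ j : ℕ, n ≤ j → 0 < g j := fun j hj =>
    mul_pos (Real.exp_pos _) (hfpos _ (by
      have : 0 < j := by omega
      exact_mod_cast this))
  have hR : ∀ j : ℕ, n ≤ j → 0 < R j := fun j hj =>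
    lt_min (mul_pos hcpos (Real.rpow_pos_of_pos (hg j hj) _)) one_pos
  have hR1 : ∀ j : ℕ, R j ≤ 1 := fun j => min_le_right _ _
  have hM : ∀ j : ℕ, n ≤ j → H / (δ * R j) ≤ M j := fun j hj => Nat.le_ceil _
  have hM1 : ∀ j : ℕ, n ≤ j → 1 ≤ M j := fun j hj =>
    Nat.one_le_iff_ne_zero.2 (Nat.pos_iff_ne_zero.1 (Nat.ceil_pos.2
      (div_pos (by linarith) (mul_pos hδ (hR j hj)))))
  have hMup : ∀ j : ℕ, n ≤ j → (M j : ℝ) ≤ 2 * H / (δ * R j) := by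
    intro j hj
    have hpos := mul_pos hδ (hR j hj)
    have h1 := Nat.ceil_lt_add_one (a := H / (δ * R j)) (by positivity)
    have h2 : 1 ≤ H / (δ * R j) := by
      rw [le_div_iff₀ hpos]
      nlinarith [hR1 j, hR j hj]
    have h3 : 2 * H / (δ * R j) = H / (δ * R j) + H / (δ * R j) := by ring
    rw [h3]
    show ((⌈H / (δ * R j)⌉₊ : ℕ) : ℝ) ≤ _
    linarith
  have hexp2 : ∀ j : ℕ, n ≤ j → 2 ≤ Real.exp (j / n) := by
    intro j hj
    have h1 : (1 : ℝ) ≤ j / n := by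
      rw [le_div_iff₀ (by positivity)]
      simpa using (show (n : ℝ) ≤ j by exact_mod_cast hj)
    have := Real.add_one_le_exp ((j : ℝ) / n)
    linarith
  have hK1 : ∀ j : ℕ, n ≤ j → 1 ≤ K j := by
    intro j hj
    refine Nat.le_floor ?_
    have := hexp2 j hj
    push_cast
    linarith
  have hKlow : ∀ j : ℕ, n ≤ j → Real.exp (j / n) / 4 ≤ K j := by
    intro j hj
    have h1 : Real.exp (j / n) / 2 < K j + 1 := Nat.lt_floor_add_one _
    have h2 : (1 : ℝ) ≤ K j := by exact_mod_cast hK1 j hj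
    linarith
  have hKup : ∀ j : ℕ, 2 * (K j : ℝ) ≤ Real.exp (j / n) := by
    intro j
    have : (K j : ℝ) ≤ Real.exp (j / n) / 2 := Nat.floor_le (by positivity)
    linarith
  -- the measure bound
  set H2 : ℝ := 18 * H / δ with hH2
  have hH2pos : 0 < H2 := by positivity
  have hbd : ∀ j : ℕ, n ≤ j → 2 * (8 * (M j : ℝ) + 1) ^ m / (K j : ℝ) ^ n
      ≤ 2 * 4 ^ n * H2 ^ m * ((c ^ m)⁻¹ * (1 / f j) + Real.exp (-j)) := by
    intro j hj
    have hRp := hR j hj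
    have hfj : 0 < f j := hfpos _ (by
      have : 0 < j := by omega
      exact_mod_cast this)
    have h1 : (8 * (M j : ℝ) + 1) ≤ H2 * (R j)⁻¹ := by
      have h2 : (1 : ℝ) ≤ M j := by exact_mod_cast hM1 j hj
      have h3 := hMup j hj
      have h4 : H2 * (R j)⁻¹ = 9 * (2 * H / (δ * R j)) := by
        rw [hH2]; field_simp; ring
      rw [h4]; linarith
    have h2 : (8 * (M j : ℝ) + 1) ^ m ≤ H2 ^ m * ((R j) ^ m)⁻¹ := by
      rw [← inv_pow, ← mul_pow]
      exact pow_le_pow_left₀ (by positivity) h1 m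
    have h3 : ((R j) ^ m)⁻¹ ≤ (c ^ m)⁻¹ * (Real.exp j * (1 / f j)) + 1 := by
      rcases min_choice (c * (g j) ^ ((m : ℝ)⁻¹)) 1 with h | h
      · have h4 : R j = c * (g j) ^ ((m : ℝ)⁻¹) := h
        have h5 : (R j) ^ m = c ^ m * g j := by
          rw [h4, mul_pow, ← Real.rpow_natCast ((g j) ^ ((m : ℝ)⁻¹)), ← Real.rpow_mul (hg j hj).le,
            inv_mul_cancel₀ hmR, Real.rpow_one]
        have h6 : (g j)⁻¹ = Real.exp j * (1 / f j) := by
          show (Real.exp (-j) * f j)⁻¹ = _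
          rw [mul_inv, Real.exp_neg, inv_inv, one_div]
        rw [h5, mul_inv, h6]
        linarith
      · have h4 : R j = 1 := h
        rw [h4, one_pow, inv_one]
        have : 0 ≤ (c ^ m)⁻¹ * (Real.exp j * (1 / f j)) := by positivity
        linarith
    have h4 : Real.exp j / 4 ^ n ≤ (K j : ℝ) ^ n := by
      have h5 := pow_le_pow_left₀ (by positivity) (hKlow j hj) n
      rw [div_pow, ← Real.exp_nat_mul] at h5
      have h6 : (n : ℝ) * (j / n) = j := by field_simp
      rwa [h6] at h5
    have hKp : (0 : ℝ) < (K j : ℝ) ^ n := lt_of_lt_of_le (by positivity) h4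
    rw [div_le_iff₀ hKp]
    set Z : ℝ := (c ^ m)⁻¹ * (1 / f j) + Real.exp (-j) with hZ
    have hZpos : 0 < Z := by positivity
    have h7 : (c ^ m)⁻¹ * (Real.exp j * (1 / f j)) + 1 = Real.exp j * Z := by
      rw [hZ, mul_add, ← Real.exp_add]
      simp
      ring
    calc 2 * (8 * (M j : ℝ) + 1) ^ m ≤ 2 * (H2 ^ m * (Real.exp j * Z)) := by
          rw [← h7]
          have := mul_le_mul_of_nonneg_left h3 (by positivity : 0 ≤ H2 ^ m)
          linarith
      _ = 2 * 4 ^ n * H2 ^ m * Z * (Real.exp j / 4 ^ n) := by field_simp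
      _ ≤ _ := mul_le_mul_of_nonneg_left h4 (by positivity)
  have hsum : Summable fun i : ℕ =>
      2 * 4 ^ n * H2 ^ m * ((c ^ m)⁻¹ * (1 / f ((i + n : ℕ) : ℝ)) + Real.exp (-((i + n : ℕ) : ℝ))) := by
    refine Summable.mul_left _ (Summable.add (Summable.mul_left _ ?_) ?_)
    · have h := (summable_nat_add_iff (n - 1)).2 hfsum
      refine h.congr fun i => ?_
      have : ((i + (n - 1) : ℕ) : ℝ) + 1 = ((i + n : ℕ) : ℝ) := by
        have h2 : i + n = i + (n - 1) + 1 := by omega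
        rw [h2]; push_cast; ring
      rw [this]
    · exact (summable_nat_add_iff (f := fun i : ℕ => Real.exp (-(i : ℝ))) n).2 Real.summable_exp_neg_nat
  refine ae_of_cubes _ fun z => ?_
  have hBC : ∀ᵐ B ∂(cubeM z), ∀ᶠ i : ℕ in Filter.atTop,
      B ∉ {B : Fin m → Fin n → ℝ | ((K (i + n) : ℝ) ^ n) ^ 2 / 2 < offd (K (i + n)) (M (i + n)) B} := by
    refine ae_eventually_notMem (ne_top_of_le_ne_top hsum.tsum_ofReal_ne_top ?_)
    refine ENNReal.tsum_le_tsum fun i => ?_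
    refine (meas_bad z _ _ (hK1 (i + n) (by omega))).trans (ENNReal.ofReal_le_ofReal ?_)
    exact hbd (i + n) (by omega)
  filter_upwards [hBC] with B hB
  obtain ⟨i0, hi0⟩ := Filter.eventually_atTop.1 hB
  refine ⟨Real.exp ((i0 + n : ℕ) : ℝ), Real.exp_pos _, fun Q hQ => ?_⟩
  have hQpos : 0 < Q := lt_of_lt_of_le (Real.exp_pos _) hQ
  have hlog : ((i0 + n : ℕ) : ℝ) ≤ Real.log Q := (Real.le_log_iff_exp_le hQpos).2 hQ
  set j : ℕ := ⌊Real.log Q⌋₊ with hj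
  have hj1 : i0 + n ≤ j := Nat.le_floor hlog
  have hjn : n ≤ j := by omega
  have hj2 : (j : ℝ) ≤ Real.log Q := Nat.floor_le (le_trans (by positivity) hlog)
  have hj3 : Real.log Q < j + 1 := Nat.lt_floor_add_one _
  have hgood : offd (K j) (M j) B ≤ ((K j : ℝ) ^ n) ^ 2 / 2 := by
    have h := hi0 (j - n) (by omega)
    rw [Nat.sub_add_cancel hjn, not_lt] at h
    exact h
  have hQn : 2 * (K j : ℝ) ≤ Q ^ ((n : ℝ)⁻¹) := by
    refine (hKup j).trans ?_
    rw [Real.rpow_def_of_pos hQpos, Real.exp_le_exp, div_eq_mul_inv]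
    exact mul_le_mul_of_nonneg_right hj2 (by positivity)
  have hCM : (m : ℝ) * 2 ^ m ≤ (δ * R j) * M j := by
    have := hM j hjn
    rw [div_le_iff₀ (mul_pos hδ (hR j hjn))] at this
    linarith
  have hgap : ∀ v, gap p S B Q v ≤ ENNReal.ofReal (C2 * R j) := fun v =>
    gap_le hm p S C hC hlp w δ hδ hδ1 hw B (K j) (M j) (hK1 j hjn) (hM1 j hjn) (R j) (hR j hjn)
      hCM hgood Q hQn v
  have hjpos : (0 : ℝ) < j := by
    have : 0 < j := by omega
    exact_mod_cast this
  have hfin : C2 * R j < Q ^ (-(m : ℝ)⁻¹) * f (Real.log Q) ^ ((m : ℝ)⁻¹) := by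
    have hfj : 0 < f j := hfpos _ hjpos
    have hff : f j ≤ f (Real.log Q) := hfmono hjpos (lt_of_lt_of_le hjpos hj2) hj2
    have hP : 0 < (g j) ^ ((m : ℝ)⁻¹) := Real.rpow_pos_of_pos (hg j hjn) _
    have h1 : C2 * R j ≤ 1 / 3 * (g j) ^ ((m : ℝ)⁻¹) := by
      calc C2 * R j ≤ C2 * (c * (g j) ^ ((m : ℝ)⁻¹)) :=
            mul_le_mul_of_nonneg_left (min_le_left _ _) hC2pos.le
        _ = _ := by rw [hc]; field_simp
    have hQe : Real.exp (-(1 : ℝ)) * Real.exp (-(j : ℝ)) ≤ Q⁻¹ := by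
      rw [← Real.exp_log hQpos, ← Real.exp_neg, ← Real.exp_add, Real.exp_le_exp]
      linarith
    have hE1 : (1 / 3 : ℝ) < Real.exp (-1) := by
      rw [Real.exp_neg, one_div]
      exact inv_strictAnti₀ (Real.exp_pos _) (by linarith [Real.exp_one_lt_d9])
    have hE2 : (1 / 3 : ℝ) < Real.exp (-1) ^ ((m : ℝ)⁻¹) := by
      refine hE1.trans_le ?_
      have hm1 : (m : ℝ)⁻¹ ≤ 1 := inv_le_one_of_one_le₀ (by exact_mod_cast hm)
      rw [← Real.exp_mul, Real.exp_le_exp]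
      linarith
    calc C2 * R j ≤ 1 / 3 * (g j) ^ ((m : ℝ)⁻¹) := h1
      _ < Real.exp (-1) ^ ((m : ℝ)⁻¹) * (g j) ^ ((m : ℝ)⁻¹) := mul_lt_mul_of_pos_right hE2 hP
      _ = (Real.exp (-1) * g j) ^ ((m : ℝ)⁻¹) :=
          (Real.mul_rpow (Real.exp_pos _).le (hg j hjn).le).symm
      _ ≤ (Q⁻¹ * f (Real.log Q)) ^ ((m : ℝ)⁻¹) := by
          refine Real.rpow_le_rpow (mul_pos (Real.exp_pos _) (hg j hjn)).le ?_ (by positivity)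
          show Real.exp (-1) * (Real.exp (-j) * f j) ≤ _
          rw [← mul_assoc]
          exact mul_le_mul hQe hff hfj.le (by positivity)
      _ = _ := by
          rw [Real.mul_rpow (by positivity) (hfj.le.trans hff), Real.rpow_neg hQpos.le,
            Real.inv_rpow hQpos.le]
  have hpos : 0 < Q ^ (-(m : ℝ)⁻¹) * f (Real.log Q) ^ ((m : ℝ)⁻¹) :=
    lt_trans (mul_pos hC2pos (hR j hjn)) hfin
  have hlt : ENNReal.ofReal (C2 * R j)
      < ENNReal.ofReal (Q ^ (-(m : ℝ)⁻¹) * f (Real.log Q) ^ ((m : ℝ)⁻¹)) :=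
    (ENNReal.ofReal_lt_ofReal_iff hpos).2 hfin
  exact ⟨(iSup_le hgap).trans_lt hlt, fun k _ => (hgap _).trans_lt hlt⟩
end

section
/- Let f : ℝ_{>0} → ℝ_{>0} be an increasing function with ∑_{k=1}^∞ 1/f(k) < ∞, and let φ : ℝ_{>0} → ℝ_{>0} be a decreasing function satisfying φ(Q) ≥ Q^{−1} f(log Q) for all Q > 0. Then for almost every m×n real matrix B the following holds: for every positive integer N there exists Q₀ > 0 (depending on B and N) such that for all Q ≥ Q₀ and every residue class c ∈ ℤ^d modulo N there exist n ∈ ℤ^n and m ∈ ℤ^m with (n, m) ≡ c (mod N), ‖Bn − m‖_∞^m < N^m φ(Q), and ‖n‖_∞^n < (N/2)^n Q. -/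
open MeasureTheory
open scoped ENNReal

theorem cs_supp {T : Type*} [MeasurableSpace T] (ν : Measure T) (g : T → ℝ≥0∞) (hg : Measurable g) :
    (∫⁻ t, g t ∂ν) ^ 2 ≤ (∫⁻ t, g t ^ 2 ∂ν) * ν {t | g t ≠ 0} := by
  have hS : MeasurableSet {t | g t ≠ 0} := hg (measurableSet_singleton 0).compl
  have h := ENNReal.lintegral_mul_le_Lp_mul_Lq ν Real.HolderConjugate.two_two hg.aemeasurable
    (g := Set.indicator {t | g t ≠ 0} 1) (measurable_one.indicator hS).aemeasurable
  have e1 : ∫⁻ t, (g * Set.indicator {t | g t ≠ 0} (1 : T → ℝ≥0∞)) t ∂ν = ∫⁻ t, g t ∂ν := by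
    congr 1; ext t; by_cases h : g t = 0 <;> simp [Set.indicator, h]
  have e2 : ∫⁻ t, (Set.indicator {t | g t ≠ 0} (1 : T → ℝ≥0∞) t) ^ (2:ℝ) ∂ν = ν {t | g t ≠ 0} := by
    rw [← lintegral_indicator_one hS]
    congr 1; ext t; by_cases h : g t = 0 <;> simp [Set.indicator, h]
  rw [e1, e2] at h
  calc (∫⁻ t, g t ∂ν) ^ 2 ≤ ((∫⁻ a, g a ^ (2:ℝ) ∂ν) ^ (1 / 2 : ℝ) * ν {t | g t ≠ 0} ^ (1 / 2 : ℝ)) ^ 2 := by gcongr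
    _ = _ := by
      rw [mul_pow, ← ENNReal.rpow_natCast, ← ENNReal.rpow_natCast, ← ENNReal.rpow_mul, ← ENNReal.rpow_mul]
      simp

theorem prob_bad {Ω T ι : Type*} [MeasurableSpace Ω] (P : Measure Ω) [IsProbabilityMeasure P]
    [AddCommGroup T] [MeasurableSpace T] [MeasurableAdd₂ T] [MeasurableNeg T]
    (ν : Measure T) [IsProbabilityMeasure ν] [ν.IsAddLeftInvariant] [Fintype ι] [Nonempty ι]
    (X : ι → Ω → T) (hX : ∀ a, Measurable (X a))
    (hpair : ∀ a a', a ≠ a' → MeasurePreserving (fun ω => X a' ω - X a ω) P ν)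
    (I : Set T) (hI : MeasurableSet I) (hI0 : ν I ≠ 0) :
    P {ω | ∃ y, ∀ a a', ∀ u ∈ I, ∀ v ∈ I, y + X a ω - X a' ω ≠ u - v} ≤
      ((Fintype.card ι : ℝ≥0∞) * ν I)⁻¹ := by
  classical
  set χ : T → ℝ≥0∞ := I.indicator 1 with hχ
  have mχ : Measurable χ := measurable_one.indicator hI
  have iχ : ∫⁻ t, χ t ∂ν = ν I := lintegral_indicator_one hI
  have iχs : ∀ c, ∫⁻ t, χ (t - c) ∂ν = ν I := by
    intro c
    rw [← iχ, ← lintegral_add_left_eq_self χ (-c)]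
    congr 1; ext t; congr 1; abel
  let g : Ω → T → ℝ≥0∞ := fun ω t => ∑ a, χ (t - X a ω)
  have mg : Measurable (fun p : Ω × T => g p.1 p.2) := by
    refine Finset.measurable_sum _ fun a _ => mχ.comp ?_
    exact measurable_snd.sub ((hX a).comp measurable_fst)
  have mgω : ∀ ω, Measurable (g ω) := fun ω => mg.comp measurable_prodMk_left
  set μ : ℝ≥0∞ := (Fintype.card ι : ℝ≥0∞) * ν I with hμ
  have hμ0 : μ ≠ 0 := mul_ne_zero (by simp) hI0
  have hμt : μ ≠ ⊤ := ENNReal.mul_ne_top (by simp) (measure_ne_top _ _)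
  have ig : ∀ ω, ∫⁻ t, g ω t ∂ν = μ := by
    intro ω
    simp only [g]
    have mm : ∀ a, Measurable fun t => χ (t - X a ω) := fun a => mχ.comp (measurable_id.sub_const _)
    rw [lintegral_finsetSum _ (fun a _ => mm a)]
    simp [iχs, hμ]
  let Y : Ω → ℝ≥0∞ := fun ω => ∫⁻ t, g ω t ^ 2 ∂ν
  have mY : Measurable Y := (mg.pow_const 2).lintegral_prod_right'
  have hY1 : ∀ ω, μ ^ 2 ≤ Y ω := by
    intro ω
    have := cs_supp ν (g ω) (mgω ω)
    rw [ig] at this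
    exact this.trans (mul_le_of_le_one_right' prob_le_one)
  have hYint : ∫⁻ ω, Y ω ∂P ≤ μ ^ 2 + μ := by
    have key : ∀ a a', ∫⁻ ω, ∫⁻ t, χ (t - X a ω) * χ (t - X a' ω) ∂ν ∂P ≤
        ν I ^ 2 + if a = a' then ν I else 0 := by
      intro a a'
      by_cases h : a = a'
      · subst h
        simp only [if_true]
        refine le_trans ?_ le_add_self
        calc _ = ∫⁻ ω, ∫⁻ t, χ (t - X a ω) ∂ν ∂P := by
              congr 1; ext ω; congr 1; ext t
              by_cases ht : t - X a ω ∈ I <;> simp [hχ, ht]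
          _ ≤ _ := by simp [iχs]
      · simp only [h, if_false, add_zero]
        have e : ∀ ω, ∫⁻ t, χ (t - X a ω) * χ (t - X a' ω) ∂ν
            = ∫⁻ t, χ (t + (X a' ω - X a ω)) * χ t ∂ν := by
          intro ω
          rw [← lintegral_add_left_eq_self _ (X a' ω)]
          congr 1; ext t; congr 2 <;> abel
        simp_rw [e]
        have hm := (hpair a a' h).measurable
        rw [lintegral_lintegral_swap]
        swap
        · exact ((mχ.comp (measurable_snd.add (hm.comp measurable_fst))).mul
            (mχ.comp measurable_snd)).aemeasurable
        have e2 : ∀ t, ∫⁻ ω, χ (t + (X a' ω - X a ω)) * χ t ∂P = ν I * χ t := by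
          intro t
          have mm : Measurable fun ω => χ (t + (X a' ω - X a ω)) := mχ.comp (hm.const_add t)
          rw [lintegral_mul_const _ mm]
          congr 1
          rw [(hpair a a' h).lintegral_comp (f := fun s => χ (t + s)) (mχ.comp (measurable_const_add t)),
            lintegral_add_left_eq_self, iχ]
        simp_rw [e2]
        rw [lintegral_const_mul _ mχ, iχ, sq]
    have e : ∀ ω, Y ω = ∑ a, ∑ a', ∫⁻ t, χ (t - X a ω) * χ (t - X a' ω) ∂ν := by
      intro ω
      simp only [Y, g, sq, Finset.sum_mul_sum]
      have mm : ∀ a a', Measurable fun t => χ (t - X a ω) * χ (t - X a' ω) := fun a a' =>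
        (mχ.comp (measurable_id.sub_const _)).mul (mχ.comp (measurable_id.sub_const _))
      rw [lintegral_finsetSum _ (fun a _ => Finset.measurable_sum _ fun a' _ => mm a a')]
      congr 1; ext a
      rw [lintegral_finsetSum _ (fun a' _ => mm a a')]
    have mm : ∀ a a', Measurable fun ω => ∫⁻ t, χ (t - X a ω) * χ (t - X a' ω) ∂ν := fun a a' => by
      refine Measurable.lintegral_prod_right' (f := fun p : Ω × T => χ (p.2 - X a p.1) * χ (p.2 - X a' p.1)) ?_
      exact (mχ.comp (measurable_snd.sub ((hX a).comp measurable_fst))).mul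
        (mχ.comp (measurable_snd.sub ((hX a').comp measurable_fst)))
    simp_rw [e]
    rw [lintegral_finsetSum _ (fun a _ => Finset.measurable_sum _ fun a' _ => mm a a')]
    calc _ = ∑ a, ∑ a', ∫⁻ ω, ∫⁻ t, χ (t - X a ω) * χ (t - X a' ω) ∂ν ∂P := by
          congr 1; ext a
          rw [lintegral_finsetSum _ (fun a' _ => mm a a')]
      _ ≤ ∑ a : ι, ∑ a' : ι, (ν I ^ 2 + if a = a' then ν I else 0) :=
          Finset.sum_le_sum fun a _ => Finset.sum_le_sum fun a' _ => key a a'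
      _ = μ ^ 2 + μ := by
          simp [Finset.sum_add_distrib, hμ]; ring
  have hsub : {ω | ∃ y, ∀ a a', ∀ u ∈ I, ∀ v ∈ I, y + X a ω - X a' ω ≠ u - v} ⊆
      {ω | μ ^ 2 ≤ Y ω - μ ^ 2} := by
    rintro ω ⟨y, hy⟩
    have hS : MeasurableSet {t | g ω t ≠ 0} := mgω ω (measurableSet_singleton 0).compl
    set S := {t | g ω t ≠ 0} with hSdef
    have memS : ∀ t, t ∈ S ↔ ∃ a, t - X a ω ∈ I := by
      intro t; simp [hSdef, g, hχ]
    have hd : Disjoint S ((fun t => y + t) ⁻¹' S) := by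
      rw [Set.disjoint_left]
      intro t h1 h2
      obtain ⟨a, ha⟩ := (memS t).1 h1
      obtain ⟨a', ha'⟩ := (memS _).1 h2
      refine hy a a' _ ha' _ ha ?_
      simp only
      abel
    have h2 : ν S + ν S ≤ 1 := by
      calc ν S + ν S = ν S + ν ((fun t => y + t) ⁻¹' S) := by rw [measure_preimage_add]
        _ = ν (S ∪ _) := (measure_union hd (measurable_const_add y hS)).symm
        _ ≤ 1 := prob_le_one
    have h3 := cs_supp ν (g ω) (mgω ω)
    rw [ig] at h3
    have h4 : μ ^ 2 + μ ^ 2 ≤ Y ω := by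
      calc μ ^ 2 + μ ^ 2 ≤ Y ω * ν S + Y ω * ν S := by gcongr
        _ = Y ω * (ν S + ν S) := by ring
        _ ≤ Y ω := mul_le_of_le_one_right' h2
    exact ENNReal.le_sub_of_add_le_right (by finiteness) h4
  refine (measure_mono hsub).trans ?_
  have h5 : μ ^ 2 * P {ω | μ ^ 2 ≤ Y ω - μ ^ 2} ≤ μ := by
    refine (mul_meas_ge_le_lintegral (mY.sub_const _) _).trans ?_
    rw [lintegral_sub measurable_const (by simp; finiteness) (Filter.Eventually.of_forall hY1)]
    simp only [lintegral_const, measure_univ, mul_one]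
    exact tsub_le_iff_left.2 hYint
  rw [← ENNReal.mul_le_mul_iff_right (a := μ ^ 2) (by positivity) (by finiteness)]
  refine h5.trans (le_of_eq ?_)
  rw [sq, mul_assoc, ENNReal.mul_inv_cancel hμ0 hμt, mul_one]

instance T0 : IsProbabilityMeasure (volume : Measure (UnitAddCircle)) := ⟨by simp⟩
instance T2 (n:ℕ): BorelSpace (Fin n → UnitAddCircle) := inferInstance
instance T3 (n:ℕ) : IsProbabilityMeasure (volume : Measure (Fin n → UnitAddCircle)) := inferInstance
instance T8 (n:ℕ) : Measure.IsAddHaarMeasure (volume : Measure (Fin n → UnitAddCircle)) := inferInstance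
instance T6 (n m:ℕ): BorelSpace (Fin m → Fin n → UnitAddCircle) := Pi.borelSpace
instance T9 (n:ℕ): MeasurableAdd (Fin n → UnitAddCircle) := inferInstance
instance T5 (n m:ℕ): Measure.IsAddHaarMeasure (volume : Measure (Fin m → Fin n → UnitAddCircle)) := 
  MeasureTheory.Measure.pi.isAddHaarMeasure (fun _ => volume)
instance T7 (n m:ℕ): IsProbabilityMeasure (volume : Measure (Fin m → Fin n → UnitAddCircle)) := 
  inferInstanceAs (IsProbabilityMeasure (Measure.pi fun _ => volume))

/-- The linear form `β ↦ (∑ a_j β_ij)_i` on the torus. -/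
def torForm {m n : ℕ} (a : Fin n → ℤ) :
    (Fin m → Fin n → UnitAddCircle) →+ (Fin m → UnitAddCircle) where
  toFun β i := ∑ j, a j • β i j
  map_zero' := by ext i; simp
  map_add' x y := by ext i; simp [Finset.sum_add_distrib]

theorem torForm_cont {m n : ℕ} (a : Fin n → ℤ) : Continuous (torForm (m := m) a) := by
  simp only [torForm, AddMonoidHom.coe_mk, ZeroHom.coe_mk]
  fun_prop

theorem torForm_mp {m n : ℕ} (a : Fin n → ℤ) (ha : a ≠ 0) :
    MeasurePreserving (torForm (m := m) a) volume volume := by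
  refine AddMonoidHom.measurePreserving (torForm_cont a) ?_ (by simp)
  intro y
  obtain ⟨j, hj⟩ := Function.ne_iff.1 ha
  refine ⟨fun i => Pi.single j (DivisibleBy.div (y i) (a j)), ?_⟩
  ext i
  simp only [torForm, AddMonoidHom.coe_mk, ZeroHom.coe_mk]
  rw [Finset.sum_eq_single j]
  · simp only [Pi.single_eq_same]
    exact DivisibleBy.div_cancel _ hj
  · intro b _ hb
    simp [hb]
  · simp

structure NiceCover {X Y : Type*} [MeasurableSpace X] [MeasurableSpace Y]
    (f : X → Y) (μ : Measure X) (ν : Measure Y) : Prop where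
  ex : ∃ (K : Type) (_ : Countable K) (S : K → Set X), (⋃ k, S k) = Set.univ ∧
    ∀ k, MeasurePreserving f (μ.restrict (S k)) ν

theorem NiceCover.pi {X Y : Type*} [MeasurableSpace X] [MeasurableSpace Y]
    {f : X → Y} {μ : Measure X} {ν : Measure Y} [SigmaFinite μ] [SigmaFinite ν]
    (h : NiceCover f μ ν) (n : ℕ) :
    NiceCover (fun (x : Fin n → X) i => f (x i)) (Measure.pi fun _ => μ) (Measure.pi fun _ => ν) := by
  obtain ⟨K, hK, S, hS, hm⟩ := h
  refine ⟨Fin n → K, inferInstance, fun k => Set.univ.pi fun i => S (k i), ?_, fun k => ?_⟩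
  · rw [Set.eq_univ_iff_forall] at hS ⊢
    intro x
    choose k hk using fun i => Set.mem_iUnion.1 (hS (x i))
    exact Set.mem_iUnion.2 ⟨k, fun i _ => hk i⟩
  · rw [Measure.restrict_pi_pi]
    exact measurePreserving_pi _ _ fun i => hm (k i)

theorem NiceCover.ae {X Y : Type*} [MeasurableSpace X] [MeasurableSpace Y]
    {f : X → Y} {μ : Measure X} {ν : Measure Y} 
    (h : NiceCover f μ ν) {p : Y → Prop} (hp : ∀ᵐ y ∂ν, p y) : ∀ᵐ x ∂μ, p (f x) := by
  obtain ⟨K, hK, S, hS, hm⟩ := h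
  rw [← Measure.restrict_univ (μ := μ), ← hS, ae_restrict_iUnion_iff]
  exact fun k => (hm k).quasiMeasurePreserving.ae hp

theorem nice_circle : NiceCover ((↑) : ℝ → UnitAddCircle) volume volume := by
  refine ⟨ℤ, inferInstance, fun k => Set.Ioc (k : ℝ) (k + 1), ?_, fun k => UnitAddCircle.measurePreserving_mk k⟩
  exact iUnion_Ioc_intCast ℝ

theorem ae_transfer {m n : ℕ} {p : (Fin m → Fin n → UnitAddCircle) → Prop} (hp : ∀ᵐ y, p y) :
    ∀ᵐ B : Fin m → Fin n → ℝ, p (fun i j => (B i j : UnitAddCircle)) :=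
  ((nice_circle.pi n).pi m).ae hp

/-- The real size of the boxes at step `k`. -/
noncomputable def dl (m : ℕ) (f : ℝ → ℝ) (k : ℕ) : ℝ :=
  (Real.exp (-(k + 1)) * f k) ^ (1 / m : ℝ)

/-- The number of integer points per coordinate at step `k`. -/
noncomputable def Kn (n : ℕ) (k : ℕ) : ℕ := ⌊Real.exp (k / n) / 2⌋₊

/-- The bad set at step `k`. -/
def badSet (m n : ℕ) (f : ℝ → ℝ) (k : ℕ) : Set (Fin m → Fin n → UnitAddCircle) :=
  {ω | ∃ y, ∀ a a' : Fin n → Fin (Kn n k),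
    ∀ u ∈ Metric.closedBall (0 : Fin m → UnitAddCircle) (dl m f k / 4),
    ∀ v ∈ Metric.closedBall (0 : Fin m → UnitAddCircle) (dl m f k / 4),
      y + torForm (fun j => ((a j : ℕ) : ℤ)) ω - torForm (fun j => ((a' j : ℕ) : ℤ)) ω ≠ u - v}

theorem Kn_ge {n k : ℕ} (hn : 1 ≤ n) (hk : n ≤ k) : Real.exp (k / n) / 4 ≤ Kn n k := by
  have h1 : (1:ℝ) ≤ k / n := by
    rw [le_div_iff₀ (by positivity)]; simpa using hk
  have h2 : (2:ℝ) ≤ Real.exp (k / n) := by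
    have := Real.add_one_le_exp ((k:ℝ) / n); linarith
  have h3 := Nat.lt_floor_add_one (Real.exp (k / n) / 2)
  have h4 : 1 ≤ Kn n k := Nat.le_floor (by push_cast; linarith)
  have h5 : (1:ℝ) ≤ Kn n k := by exact_mod_cast h4
  unfold Kn at *
  linarith

theorem bad_le (m n : ℕ) (hm : 1 ≤ m) (hn : 1 ≤ n) (f : ℝ → ℝ) (k : ℕ) (hk : n ≤ k)
    (hf : 0 < f k) :
    volume (badSet m n f k) ≤
      ENNReal.ofReal (4 ^ n * Real.exp (-k) + 4 ^ n * 2 ^ m * Real.exp 1 * (1 / f k)) := by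
  have hδ : 0 < dl m f k := by unfold dl; positivity
  have hδm : dl m f k ^ m = Real.exp (-(k + 1)) * f k := by
    unfold dl
    rw [one_div, Real.rpow_inv_natCast_pow (by positivity) (by omega)]
  have hK := Kn_ge hn hk
  have hK0 : (0:ℝ) < Kn n k := lt_of_lt_of_le (by positivity) hK
  have hK0' : 0 < Kn n k := by exact_mod_cast hK0
  have hvol : volume (Metric.closedBall (0 : Fin m → UnitAddCircle) (dl m f k / 4)) =
      ENNReal.ofReal ((min 1 (dl m f k / 2)) ^ m) := by
    rw [volume_pi_closedBall _ (by positivity)]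
    have e : 2 * (dl m f k / 4) = dl m f k / 2 := by ring
    simp only [AddCircle.volume_closedBall, e]
    rw [Finset.prod_const, Finset.card_univ, Fintype.card_fin, ENNReal.ofReal_pow (by positivity)]
  have : Nonempty (Fin n → Fin (Kn n k)) := ⟨fun _ => ⟨0, hK0'⟩⟩
  have h := prob_bad (volume : Measure (Fin m → Fin n → UnitAddCircle))
    (volume : Measure (Fin m → UnitAddCircle))
    (fun (a : Fin n → Fin (Kn n k)) ω => torForm (fun j => ((a j : ℕ) : ℤ)) ω)
    (fun a => (torForm_cont _).measurable) ?_
    (Metric.closedBall (0 : Fin m → UnitAddCircle) (dl m f k / 4)) measurableSet_closedBall ?_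
  · refine le_trans h ?_
    rw [hvol]
    have e : (Fintype.card (Fin n → Fin (Kn n k)) : ℝ≥0∞) = ENNReal.ofReal ((Kn n k : ℝ) ^ n) := by
      rw [ENNReal.ofReal_pow (by positivity)]
      simp
    rw [e, ← ENNReal.ofReal_mul (by positivity), ← ENNReal.ofReal_inv_of_pos (by positivity)]
    apply ENNReal.ofReal_le_ofReal
    have hKn : Real.exp k / 4 ^ n ≤ (Kn n k : ℝ) ^ n := by
      calc Real.exp k / 4 ^ n = (Real.exp (k / n) / 4) ^ n := by
            rw [div_pow, ← Real.exp_nat_mul]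
            congr 2; field_simp
        _ ≤ _ := by gcongr
    have hp : 0 < 4 ^ n * Real.exp (-(k:ℝ)) := by positivity
    have hq : 0 < 4 ^ n * 2 ^ m * Real.exp 1 * (1 / f k) := by positivity
    rcases le_total 1 (dl m f k / 2) with h1 | h1
    · rw [min_eq_left h1, one_pow, mul_one]
      calc _ ≤ (Real.exp k / 4 ^ n)⁻¹ := by gcongr
        _ = 4 ^ n * Real.exp (-(k:ℝ)) := by rw [Real.exp_neg]; field_simp
        _ ≤ _ := by linarith
    · rw [min_eq_right h1, div_pow, hδm]
      calc _ ≤ (Real.exp k / 4 ^ n * (Real.exp (-(k + 1)) * f k / 2 ^ m))⁻¹ := by gcongr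
        _ = 4 ^ n * 2 ^ m * Real.exp 1 * (1 / f k) := by
          rw [Real.exp_neg, Real.exp_add]; field_simp
        _ ≤ _ := by linarith
  · intro a a' haa
    have hne : (fun j => ((a' j : ℕ) : ℤ) - ((a j : ℕ) : ℤ)) ≠ 0 := by
      intro h0
      apply haa
      ext j
      have := congrFun h0 j
      simp only [Pi.zero_apply] at this
      omega
    convert torForm_mp (m := m) _ hne using 1
    ext ω i
    simp [torForm, sub_smul]
  · rw [hvol]
    simp only [ne_eq, ENNReal.ofReal_eq_zero, not_le]
    positivity

theorem ae_good (m n : ℕ) (hm : 1 ≤ m) (hn : 1 ≤ n) (f : ℝ → ℝ) (hfpos : ∀ x > (0 : ℝ), 0 < f x)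
    (hfsum : Summable fun k : ℕ => 1 / f (k + 1)) :
    ∀ᵐ β : Fin m → Fin n → UnitAddCircle, ∀ᶠ k in Filter.atTop, β ∉ badSet m n f k := by
  have hs : Summable fun k : ℕ => 4 ^ n * Real.exp (-((k + n : ℕ):ℝ)) +
      4 ^ n * 2 ^ m * Real.exp 1 * (1 / f ((k + n : ℕ):ℝ)) := by
    refine Summable.add (Summable.mul_left _ ?_) (Summable.mul_left _ ?_)
    · exact (summable_nat_add_iff (f := fun k : ℕ => Real.exp (-(k:ℝ))) n).2 Real.summable_exp_neg_nat
    · refine (summable_nat_add_iff (f := fun k : ℕ => 1 / f (k:ℝ)) n).2 ?_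
      refine (summable_nat_add_iff (f := fun k : ℕ => 1 / f (k:ℝ)) 1).1 ?_
      simpa using hfsum
  have hpos : ∀ k : ℕ, 0 < f ((k + n : ℕ):ℝ) := fun k => hfpos _ (by
    have : 0 < k + n := by omega
    exact_mod_cast this)
  have ht : ∑' k, volume (badSet m n f (k + n)) ≠ ⊤ := by
    refine ne_top_of_le_ne_top ?_ (ENNReal.tsum_le_tsum fun k =>
      bad_le m n hm hn f (k + n) (by omega) (hpos k))
    rw [← ENNReal.ofReal_tsum_of_nonneg _ hs]
    · exact ENNReal.ofReal_ne_top
    · intro k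
      have := hpos k
      positivity
  filter_upwards [ae_eventually_notMem ht] with β hβ
  rw [Filter.eventually_atTop] at hβ ⊢
  obtain ⟨k0, h0⟩ := hβ
  refine ⟨k0 + n, fun k hk => ?_⟩
  have := h0 (k - n) (by omega)
  rwa [Nat.sub_add_cancel (by omega)] at this

theorem good_solves (m n : ℕ) (hm : 1 ≤ m) (hn : 1 ≤ n) (f : ℝ → ℝ) (k : ℕ) (hf : 0 < f k)
    (B : Fin m → Fin n → ℝ)
    (hB : (fun i j => (B i j : UnitAddCircle)) ∉ badSet m n f k) (N : ℕ) (hN : 0 < N)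
    (c₁ : Fin n → ℤ) (c₂ : Fin m → ℤ) : ∃ a : Fin n → ℤ, ∃ b : Fin m → ℤ,
        (∀ j, (N : ℤ) ∣ (a j - c₁ j)) ∧ (∀ i, (N : ℤ) ∣ (b i - c₂ i)) ∧
        ‖(fun i => matVec B (fun j => (a j : ℝ)) i - (b i : ℝ))‖ ^ m <
          (N : ℝ) ^ m * (Real.exp (-(k + 1)) * f k) ∧
        ‖(fun j => (a j : ℝ))‖ ^ n < ((N : ℝ) / 2) ^ n * Real.exp k := by
  have hδ : 0 < dl m f k := by unfold dl; positivity
  have hδm : dl m f k ^ m = Real.exp (-(k + 1)) * f k := by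
    unfold dl
    rw [one_div, Real.rpow_inv_natCast_pow (by positivity) (by omega)]
  have hN' : (0:ℝ) < N := by exact_mod_cast hN
  let p0 : Fin n → ℤ := fun j => round (-(c₁ j : ℝ) / N)
  let y : Fin m → ℝ := fun i => ∑ j, B i j * (c₁ j / N + p0 j) - c₂ i / N
  simp only [badSet, Set.mem_ofPred_eq] at hB
  push Not at hB
  obtain ⟨a, a', u, hu, v, hv, huv⟩ := hB (fun i => (y i : UnitAddCircle))
  let p : Fin n → ℤ := fun j => p0 j + (a j : ℕ) - (a' j : ℕ)
  let w : Fin m → ℝ := fun i => ∑ j, B i j * (c₁ j / N + p j) - c₂ i / N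
  have hw : ∀ i, ((w i : ℝ) : UnitAddCircle) = u i - v i := by
    intro i
    have := congrFun huv i
    simp only [Pi.add_apply, Pi.sub_apply, torForm, AddMonoidHom.coe_mk, ZeroHom.coe_mk] at this
    rw [← this]
    have e : w i = y i + ∑ j, ((a j : ℕ) : ℤ) • B i j - ∑ j, ((a' j : ℕ) : ℤ) • B i j := by
      simp only [w, y, p, zsmul_eq_mul]
      rw [sub_add_eq_add_sub, sub_right_comm, ← Finset.sum_add_distrib, ← Finset.sum_sub_distrib]
      congr 1
      refine Finset.sum_congr rfl fun j _ => ?_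
      push_cast; ring
    rw [e]
    have hsum : ∀ t : Fin n → ℝ, ((∑ j, t j : ℝ) : UnitAddCircle) = ∑ j, (t j : UnitAddCircle) := fun t =>
      map_sum (QuotientAddGroup.mk' (AddSubgroup.zmultiples (1:ℝ))) t _
    rw [AddCircle.coe_sub, AddCircle.coe_add, hsum, hsum]
    rfl
  let q : Fin m → ℤ := fun i => round (w i)
  have hq : ∀ i, |w i - q i| ≤ dl m f k / 2 := by
    intro i
    rw [← UnitAddCircle.norm_eq, hw]
    have h1 : ‖u i‖ ≤ dl m f k / 4 := (norm_le_pi_norm u i).trans (by simpa using hu)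
    have h2 : ‖v i‖ ≤ dl m f k / 4 := (norm_le_pi_norm v i).trans (by simpa using hv)
    have := norm_sub_le (u i) (v i)
    linarith
  refine ⟨fun j => c₁ j + N * p j, fun i => c₂ i + N * q i, fun j => by simp, fun i => by simp, ?_, ?_⟩
  · rw [← hδm, ← mul_pow]
    refine pow_lt_pow_left₀ ?_ (norm_nonneg _) (by omega)
    refine lt_of_le_of_lt ((pi_norm_le_iff_of_nonneg (r := N * (dl m f k / 2)) (by positivity)).2 ?_) ?_
    · intro i
      have e : matVec B (fun j => ((c₁ j + N * p j : ℤ) : ℝ)) i - ((c₂ i + N * q i : ℤ) : ℝ) =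
          N * (w i - q i) := by
        simp only [matVec, w]
        rw [mul_sub, mul_sub, Finset.mul_sum]
        have : ∀ j, (N:ℝ) * (B i j * (c₁ j / N + p j)) = B i j * ((c₁ j + N * p j : ℤ) : ℝ) := by
          intro j; push_cast; field_simp
        simp_rw [this]
        push_cast; field_simp; ring
      rw [e, Real.norm_eq_abs, abs_mul, abs_of_pos hN']
      gcongr
      exact hq i
    · gcongr; linarith
  · have e : ((N:ℝ) / 2) ^ n * Real.exp k = (N * (Real.exp (k / n) / 2)) ^ n := by
      rw [mul_pow, div_pow, div_pow, ← Real.exp_nat_mul]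
      have : (n:ℝ) * (k / n) = k := by field_simp
      rw [this]; ring
    rw [e]
    have hKn : (Kn n k : ℝ) ≤ Real.exp (k / n) / 2 := Nat.floor_le (by positivity)
    have j0 : Fin n := ⟨0, hn⟩
    have hK1 : (1:ℝ) ≤ Kn n k := by
      have := (a j0).2
      exact_mod_cast (by omega : 1 ≤ Kn n k)
    refine pow_lt_pow_left₀ ?_ (norm_nonneg _) (by omega)
    refine lt_of_le_of_lt ((pi_norm_le_iff_of_nonneg (r := N * (Kn n k - 1 / 2)) ?_).2 ?_) ?_
    · have : (0:ℝ) ≤ Kn n k - 1 / 2 := by linarith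
      positivity
    · intro j
      have e : ((c₁ j + N * p j : ℤ) : ℝ) = N * ((c₁ j / N + p0 j) + ((a j : ℕ) - (a' j : ℕ) : ℝ)) := by
        simp only [p]; push_cast; field_simp; ring
      rw [e, Real.norm_eq_abs, abs_mul, abs_of_pos hN']
      gcongr
      have h1 : |(c₁ j / N + p0 j : ℝ)| ≤ 1 / 2 := by
        have := abs_sub_round (-(c₁ j : ℝ) / N)
        rw [← abs_neg] at this
        have e3 : (c₁ j / N + p0 j : ℝ) = -(-(c₁ j : ℝ) / N - (round (-(c₁ j : ℝ) / N) : ℤ)) := by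
          simp only [p0]; ring
        rw [e3]
        exact this
      have h2 : |((a j : ℕ) - (a' j : ℕ) : ℝ)| ≤ Kn n k - 1 := by
        have h3 : ((a j : ℕ) : ℝ) + 1 ≤ Kn n k := by exact_mod_cast (a j).2
        have h4 : ((a' j : ℕ) : ℝ) + 1 ≤ Kn n k := by exact_mod_cast (a' j).2
        have h5 : (0:ℝ) ≤ (a j : ℕ) := by positivity
        have h6 : (0:ℝ) ≤ (a' j : ℕ) := by positivity
        rw [abs_le]; constructor <;> linarith
      have := abs_add_le (c₁ j / N + p0 j : ℝ) ((a j : ℕ) - (a' j : ℕ) : ℝ)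
      linarith
    · gcongr; linarith


/-- **Corollary, first part.** Let `f : ℝ_{>0} → ℝ_{>0}` be increasing with `∑ 1/f(k) < ∞`
and let `φ : ℝ_{>0} → ℝ_{>0}` be decreasing with `φ(Q) ≥ Q⁻¹ f(log Q)`.  Then for almost
every `m×n` real matrix `B` and every positive integer `N` there is `Q₀ > 0` such that for
all `Q ≥ Q₀`, every congruence class `c ∈ ℤ^d` modulo `N` contains a solution `(a, b)` of
`‖Ba − b‖_∞^m < N^m φ(Q)` and `‖a‖_∞^n < (N/2)^n Q`.  (Here `‖·‖` on `Fin k → ℝ` is the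
sup-norm.) -/
theorem diophantine_congruence_solvable (m n : ℕ) (hm : 1 ≤ m) (hn : 1 ≤ n)
    (f : ℝ → ℝ) (hfpos : ∀ x > (0 : ℝ), 0 < f x) (hfmono : MonotoneOn f (Set.Ioi 0))
    (hfsum : Summable fun k : ℕ => 1 / f (k + 1))
    (φ : ℝ → ℝ) (hφpos : ∀ Q > (0 : ℝ), 0 < φ Q) (hφanti : AntitoneOn φ (Set.Ioi 0))
    (hφf : ∀ Q > (1 : ℝ), Q⁻¹ * f (Real.log Q) ≤ φ Q) :
    ∀ᵐ B : Fin m → Fin n → ℝ ∂volume, ∀ N : ℕ, 0 < N → ∃ Q₀ > (0 : ℝ), ∀ Q ≥ Q₀,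
      ∀ c₁ : Fin n → ℤ, ∀ c₂ : Fin m → ℤ, ∃ a : Fin n → ℤ, ∃ b : Fin m → ℤ,
        (∀ j, (N : ℤ) ∣ (a j - c₁ j)) ∧ (∀ i, (N : ℤ) ∣ (b i - c₂ i)) ∧
        ‖(fun i => matVec B (fun j => (a j : ℝ)) i - (b i : ℝ))‖ ^ m < (N : ℝ) ^ m * φ Q ∧
        ‖(fun j => (a j : ℝ))‖ ^ n < ((N : ℝ) / 2) ^ n * Q := by
  filter_upwards [ae_transfer (ae_good m n hm hn f hfpos hfsum)] with B hB N hN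
  obtain ⟨k0, hk0⟩ := Filter.eventually_atTop.1 hB
  refine ⟨Real.exp (k0 + 1), Real.exp_pos _, fun Q hQ c₁ c₂ => ?_⟩
  have hQ0 : 0 < Q := (Real.exp_pos _).trans_le hQ
  have hl : (k0 : ℝ) + 1 ≤ Real.log Q := (Real.le_log_iff_exp_le hQ0).2 hQ
  have hl0 : (0:ℝ) ≤ k0 := by positivity
  have hk1 : k0 + 1 ≤ ⌊Real.log Q⌋₊ := Nat.le_floor (by push_cast; exact hl)
  set k := ⌊Real.log Q⌋₊ with hk
  have hkpos : (0:ℝ) < k := by exact_mod_cast (by omega : 0 < k)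
  have hkle : (k:ℝ) ≤ Real.log Q := Nat.floor_le (by linarith)
  have hklt : Real.log Q < k + 1 := Nat.lt_floor_add_one _
  have hfk : 0 < f k := hfpos _ hkpos
  obtain ⟨a, b, h1, h2, h3, h4⟩ := good_solves m n hm hn f k hfk B (hk0 k (by omega)) N hN c₁ c₂
  refine ⟨a, b, h1, h2, h3.trans_le ?_, h4.trans_le ?_⟩
  · gcongr
    have hQ1 : 1 < Q := by
      by_contra hcon
      have := Real.log_nonpos hQ0.le (not_lt.1 hcon)
      linarith
    refine le_trans ?_ (hφf Q hQ1)
    have hmono : f k ≤ f (Real.log Q) := hfmono hkpos (hkpos.trans_le hkle) hkle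
    have hexp : Real.exp (-(k + 1)) ≤ Q⁻¹ := by
      rw [Real.exp_neg]
      gcongr
      rw [← Real.log_le_iff_le_exp hQ0]
      exact hklt.le
    gcongr
  · gcongr
    rw [← Real.le_log_iff_exp_le hQ0]
    exact hkle
end
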